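/- arXiv:2506.21717 — 2 statements merged into one kernel-verified Lean document; each statement's English description precedes it below -/
import Mathlib

section
/- Let k be a field with char(k) ≠ 2, K = k(t) the rational function field, and a₁, a₂ ∈ k× with [k(√a₁,√a₂):k] = 4 and N_{k(√a₁)/k}(k(√a₁)×) ∩ N_{k(√a₂)/k}(k(√a₂)×) ⊄ k×². Then for every integer r ≥ 3 there exists a multiquadratic field extension L/K with a₁, a₂ squares in L, [L:K] = 2^r, and Λ(L/K) ≠ 0. -/
open scoped TensorProduct

/-- A (finite-dimensional) quadratic form over the field `K`, bundled with its
underlying vector space. -/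
structure QF (K : Type) [Field K] where
  V : Type
  [iAG : AddCommGroup V]
  [iM : Module K V]
  [iFD : FiniteDimensional K V]
  q : QuadraticForm K V

namespace QF

variable {K : Type} [Field K]

instance (φ : QF K) : AddCommGroup φ.V := φ.iAG
instance (φ : QF K) : Module K φ.V := φ.iM
instance (φ : QF K) : FiniteDimensional K φ.V := φ.iFD

/-- dimension of a quadratic form -/
noncomputable def dim (φ : QF K) : ℕ := Module.finrank K φ.V

/-- isometry of quadratic forms -/
def Equiv (φ ψ : QF K) : Prop := QuadraticMap.Equivalent φ.q ψ.q

/-- nondegeneracy of a quadratic form (via its polar bilinear form) -/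
def Nondeg (φ : QF K) : Prop := (QuadraticMap.polarBilin φ.q).Nondegenerate

/-- scaling a quadratic form by a scalar -/
def smul (a : K) (φ : QF K) : QF K := { V := φ.V, q := a • φ.q }

/-- orthogonal sum of quadratic forms -/
def add (φ ψ : QF K) : QF K := { V := φ.V × ψ.V, q := φ.q.prod ψ.q }

/-- the zero-dimensional quadratic form -/
noncomputable def zero : QF K := { V := Fin 0 → K, q := QuadraticMap.weightedSumSquares K (fun i : Fin 0 => (1 : K)) }

/-- the form `⟨1⟩` -/
noncomputable def one : QF K := { V := Fin 1 → K, q := QuadraticMap.weightedSumSquares K (fun _ : Fin 1 => (1 : K)) }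

/-- the binary form `⟨1, -a⟩ = ⟪a⟫` -/
noncomputable def bin (a : K) : QF K :=
  { V := Fin 2 → K, q := QuadraticMap.weightedSumSquares K ![(1 : K), -a] }

/-- tensor product of quadratic forms -/
noncomputable def tmul [Invertible (2 : K)] (φ ψ : QF K) : QF K :=
  { V := φ.V ⊗[K] ψ.V, q := QuadraticForm.tmul φ.q ψ.q }

/-- `m` copies of the hyperbolic plane `⟨1, -1⟩` -/
noncomputable def hyperbolics : ℕ → QF K
  | 0 => zero
  | m + 1 => add (bin 1) (hyperbolics m)

/-- a form is hyperbolic if it is isometric to a sum of hyperbolic planes -/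
def IsHyperbolic (φ : QF K) : Prop := ∃ m : ℕ, φ.Equiv (hyperbolics m)

/-- anisotropy -/
def Anisotropic (φ : QF K) : Prop := φ.q.Anisotropic

/-- the Witt index -/
noncomputable def wittIndex (φ : QF K) : ℕ :=
  sSup {m : ℕ | ∃ ψ : QF K, φ.Equiv (add (hyperbolics m) ψ)}

/-- a form is split if its anisotropic part has dimension at most one -/
def IsSplit (φ : QF K) : Prop :=
  ∃ (m : ℕ) (ψ : QF K), ψ.Anisotropic ∧ ψ.dim ≤ 1 ∧ φ.Equiv (add (hyperbolics m) ψ)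

/-- `n`-fold orthogonal sum of a fixed form -/
noncomputable def nsmul : ℕ → QF K → QF K
  | 0, _ => zero
  | n + 1, φ => add φ (nsmul n φ)

/-- orthogonal sum of a list of forms -/
noncomputable def sumList : List (QF K) → QF K
  | [] => zero
  | φ :: l => add φ (sumList l)

/-- the Pfister form `⟨⟨a₁, …, aₙ⟩⟩` -/
noncomputable def pfister [Invertible (2 : K)] : List K → QF K
  | [] => one
  | a :: l => tmul (bin a) (pfister l)

/-- Witt equivalence of quadratic forms -/
def WittEquiv (φ ψ : QF K) : Prop := IsHyperbolic (add φ (smul (-1) ψ))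

/-- membership in the `n`-th power of the fundamental ideal: Witt equivalence
to an orthogonal sum of scaled `n`-fold Pfister forms -/
def InFundPow [Invertible (2 : K)] (n : ℕ) (φ : QF K) : Prop :=
  ∃ (r : ℕ) (c : Fin r → K) (l : Fin r → (Fin n → K)),
    (∀ i, c i ≠ 0) ∧
    WittEquiv φ (sumList ((List.finRange r).map fun i => smul (c i) (pfister (List.ofFn (l i)))))

/-- the group of similarity factors `G(φ) = {a ∈ K× : aφ ≅ φ}`, as a set -/
def G (φ : QF K) : Set K := {a | a ≠ 0 ∧ (smul a φ).Equiv φ}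

/-- similarity factors of a family of forms -/
def GT {r : ℕ} (φ : Fin r → QF K) : Set K := ⋂ i, G (φ i)

end QF

/-- a bundled field extension of `K` -/
structure FieldExt (K : Type) [Field K] where
  carrier : Type
  [iF : Field carrier]
  [iA : Algebra K carrier]

attribute [instance] FieldExt.iF FieldExt.iA

namespace QF

variable {K : Type} [Field K]

/-- base change of a quadratic form along a field extension -/
noncomputable def baseChange [Invertible (2 : K)] (L : Type) [Field L] [Algebra K L]
    (φ : QF K) : QF L :=
  { V := L ⊗[K] φ.V, q := QuadraticForm.baseChange L φ.q }

end QF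

/-- the set of nonzero norms of a finite field extension -/
def normSet (K : Type) [Field K] (L : Type) [Field L] [Algebra K L] : Set K :=
  {a | ∃ x : L, x ≠ 0 ∧ Algebra.norm K x = a}

/-- a finite `2`-extension: a tower of quadratic extensions -/
def IsTwoExtension (K : Type) [Field K] (L : Type) [Field L] [Algebra K L] : Prop :=
  FiniteDimensional K L ∧
    ∃ (n : ℕ) (F : Fin (n + 1) → IntermediateField K L),
      F 0 = ⊥ ∧ F (Fin.last n) = ⊤ ∧
        ∀ i : Fin n, F i.castSucc ≤ F i.succ ∧
          IntermediateField.relfinrank (F i.castSucc) (F i.succ) = 2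

/-- a multiquadratic extension: Galois with elementary abelian 2-group -/
def IsMultiquadratic (K : Type) [Field K] (L : Type) [Field L] [Algebra K L] : Prop :=
  FiniteDimensional K L ∧ IsGalois K L ∧ ∀ σ : L ≃ₐ[K] L, σ * σ = 1

namespace QF

variable {K : Type} [Field K] [Invertible (2 : K)]

/-- generating set for `Hyp(φ)`: norms from finite extensions splitting `φ` -/
def hypSet (φ : QF K) : Set K :=
  {a | ∃ L : FieldExt K, FiniteDimensional K L.carrier ∧
    IsHyperbolic (baseChange L.carrier φ) ∧ a ∈ normSet K L.carrier}

/-- the subgroup `Hyp(φ)` generated by norms of finite extensions splitting `φ` -/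
def Hyp (φ : QF K) : Submonoid K := Submonoid.closure (hypSet φ)

/-- generating set for `Hyp₂(φ)`: norms from finite 2-extensions splitting `φ` -/
def hypSet2 (φ : QF K) : Set K :=
  {a | ∃ L : FieldExt K, IsTwoExtension K L.carrier ∧
    IsHyperbolic (baseChange L.carrier φ) ∧ a ∈ normSet K L.carrier}

/-- the subgroup `Hyp₂(φ)` -/
def Hyp2 (φ : QF K) : Submonoid K := Submonoid.closure (hypSet2 φ)

/-- `H(φ) = K×² · Hyp(φ)` -/
def Hgrp (φ : QF K) : Set K :=
  {x | ∃ s : K, s ≠ 0 ∧ ∃ h ∈ Hyp φ, x = s ^ 2 * h}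

/-- `K×² · Hyp₂(φ)` -/
def H2grp (φ : QF K) : Set K :=
  {x | ∃ s : K, s ≠ 0 ∧ ∃ h ∈ Hyp2 φ, x = s ^ 2 * h}

/-- the splitting pattern: the set of Witt indices over all field extensions -/
def Sp (φ : QF K) : Set ℕ :=
  {m | ∃ L : FieldExt K, m = wittIndex (baseChange L.carrier φ)}

end QF

namespace QF

variable {K : Type} [Field K] [Invertible (2 : K)]

/-- norms from finite extensions splitting all forms in a family -/
def hypSetT {r : ℕ} (φ : Fin r → QF K) : Set K :=
  {a | ∃ L : FieldExt K, FiniteDimensional K L.carrier ∧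
    (∀ i, IsHyperbolic (baseChange L.carrier (φ i))) ∧ a ∈ normSet K L.carrier}

/-- the subgroup `Hyp` of a family of forms -/
def HypT {r : ℕ} (φ : Fin r → QF K) : Submonoid K := Submonoid.closure (hypSetT φ)

/-- norms from finite 2-extensions splitting all forms in a family -/
def hypSet2T {r : ℕ} (φ : Fin r → QF K) : Set K :=
  {a | ∃ L : FieldExt K, IsTwoExtension K L.carrier ∧
    (∀ i, IsHyperbolic (baseChange L.carrier (φ i))) ∧ a ∈ normSet K L.carrier}

/-- the subgroup `Hyp₂` of a family of forms -/
def Hyp2T {r : ℕ} (φ : Fin r → QF K) : Submonoid K := Submonoid.closure (hypSet2T φ)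

/-- `H` of a family of forms: `K×² · Hyp` -/
def HgrpT {r : ℕ} (φ : Fin r → QF K) : Set K :=
  {x | ∃ s : K, s ≠ 0 ∧ ∃ h ∈ HypT φ, x = s ^ 2 * h}

end QF

/-- the map `O → O'` between valuation rings induced by a compatible field embedding -/
def liftVSHom {K M : Type} [Field K] [Field M] [Algebra K M]
    (O : ValuationSubring K) (OM : ValuationSubring M)
    (hc : ∀ x : K, x ∈ O ↔ algebraMap K M x ∈ OM) : O →+* OM where
  toFun x := ⟨algebraMap K M x, (hc x).1 x.2⟩
  map_one' := by ext; simp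
  map_mul' x y := by ext; simp
  map_zero' := by ext; simp
  map_add' x y := by ext; simp

/-- `v` is unramified in the subextension `E` of `M/K`: the value group does not grow
and the residue field extension is separable (every residue is a simple root of a
separable polynomial over the residue field of `O`) -/
def UnramifiedIn {K M : Type} [Field K] [Field M] [Algebra K M]
    (O : ValuationSubring K) (OM : ValuationSubring M)
    (hc : ∀ x : K, x ∈ O ↔ algebraMap K M x ∈ OM) (E : IntermediateField K M) : Prop :=
  (∀ y : M, y ∈ E → y ≠ 0 →
      ∃ x : K, x ≠ 0 ∧ OM.valuation y = OM.valuation (algebraMap K M x)) ∧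
  (∀ y : M, y ∈ E → ∀ hy : y ∈ OM, ∃ p : Polynomial O, p.Monic ∧
      (p.map (IsLocalRing.residue O)).Separable ∧
      Polynomial.eval (⟨y, hy⟩ : OM) (p.map (liftVSHom O OM hc)) ∈ IsLocalRing.maximalIdeal OM)

/-- the value group of a valuation, as a subgroup of the units of the codomain -/
def unitsValueGroup {L Γ : Type} [Field L] [LinearOrderedCommGroupWithZero Γ]
    (w : Valuation L Γ) : Subgroup Γˣ :=
  (Units.map w.toMonoidWithZeroHom.toMonoidHom).range

/-- iterated Laurent series field, bundled with its field structure -/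
noncomputable def IterLaurentP (k : Type) [Field k] : ℕ → Σ' (T : Type), Field T :=
  fun n => Nat.rec ⟨k, ‹Field k›⟩
    (fun _ p => by letI := p.2; exact ⟨LaurentSeries p.1, inferInstance⟩) n

/-- iterated Laurent series field `k((t₁))…((tₙ))` -/
@[reducible] noncomputable def IterLaurent (k : Type) [Field k] (n : ℕ) : Type :=
  (IterLaurentP k n).1

noncomputable instance (k : Type) [Field k] (n : ℕ) : Field (IterLaurent k n) :=
  (IterLaurentP k n).2

/-- the embedding of the coefficient field in the iterated Laurent series field -/
noncomputable def iterC (k : Type) [Field k] : ∀ n, k →+* IterLaurent k n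
  | 0 => RingHom.id k
  | n + 1 => (HahnSeries.C : IterLaurent k n →+* LaurentSeries (IterLaurent k n)).comp (iterC k n)

/-- the variables `t₁, …, tₙ` of the iterated Laurent series field -/
noncomputable def tvar (k : Type) [Field k] : ∀ n, Fin n → IterLaurent k n
  | 0 => fun i => i.elim0
  | n + 1 => fun i =>
      (Fin.lastCases (motive := fun _ => LaurentSeries (IterLaurent k n))
        (HahnSeries.single 1 1) (fun j => HahnSeries.C (tvar k n j)) i : IterLaurent k (n + 1))

namespace Aux17

open Polynomial IntermediateField


theorem quad_basis {F E : Type*} [Field F] [Field E] [Algebra F E]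
    (hfr : Module.finrank F E = 2) (x : E) (hx : ∀ c : F, algebraMap F E c ≠ x) :
    ∃ b : Module.Basis (Fin 2) F E, b 0 = 1 ∧ b 1 = x := by
  have hli : LinearIndependent F ![(1 : E), x] := by
    rw [LinearIndependent.pair_iff' one_ne_zero]
    intro a h
    exact hx a (by rw [← h, Algebra.smul_def, mul_one])
  refine ⟨basisOfLinearIndependentOfCardEqFinrank hli (by simp [hfr]), ?_, ?_⟩ <;> simp

theorem quad_repr {F E : Type*} [Field F] [Field E] [Algebra F E]
    (hfr : Module.finrank F E = 2) (x : E) (hx : ∀ c : F, algebraMap F E c ≠ x) (z : E) :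
    ∃ p q : F, z = algebraMap F E p + algebraMap F E q * x := by
  obtain ⟨b, h0, h1⟩ := quad_basis hfr x hx
  refine ⟨b.repr z 0, b.repr z 1, ?_⟩
  conv_lhs => rw [← b.sum_repr z]
  simp [Fin.sum_univ_two, h0, h1, Algebra.smul_def]

theorem quad_norm {F E : Type*} [Field F] [Field E] [Algebra F E]
    (hfr : Module.finrank F E = 2) (x : E) (hx : ∀ c : F, algebraMap F E c ≠ x)
    (a : F) (ha : x ^ 2 = algebraMap F E a) (p q : F) :
    Algebra.norm F (algebraMap F E p + algebraMap F E q * x) = p ^ 2 - a * q ^ 2 := by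
  obtain ⟨b, h0, h1⟩ := quad_basis hfr x hx
  have e0 : (algebraMap F E p + algebraMap F E q * x) * b 0 = p • b 0 + q • b 1 := by
    simp [h0, h1, Algebra.smul_def]
  have e1 : (algebraMap F E p + algebraMap F E q * x) * b 1 = (a * q) • b 0 + p • b 1 := by
    simp only [h0, h1, Algebra.smul_def, map_mul, ← ha]; ring
  rw [Algebra.norm_eq_matrix_det b, Matrix.det_fin_two]
  simp only [Algebra.leftMulMatrix_eq_repr_mul, e0, e1]
  simp
  ring

theorem finrank_adj {F E : Type*} [Field F] [Field E] [Algebra F E] (x : E)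
    (hx : ∀ c : F, algebraMap F E c ≠ x) (a : F) (ha : x ^ 2 = algebraMap F E a) :
    Module.finrank F F⟮x⟯ = 2 := by
  have hmon : (X ^ 2 - C a : F[X]).Monic := monic_X_pow_sub_C a two_ne_zero
  have hint : IsIntegral F x := ⟨X ^ 2 - C a, hmon, by simp [ha]⟩
  rw [IntermediateField.adjoin.finrank hint]
  apply le_antisymm
  · have := natDegree_le_of_dvd (minpoly.dvd F x (p := X ^ 2 - C a) (by simp [ha])) hmon.ne_zero
    simpa using this
  · rw [minpoly.two_le_natDegree_iff hint]
    rintro ⟨c, hc⟩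
    exact hx c hc

theorem gen_ne {F E : Type*} [Field F] [Field E] [Algebra F E] (x : E)
    (hx : ∀ c : F, algebraMap F E c ≠ x) (c : F) :
    algebraMap F F⟮x⟯ c ≠ AdjoinSimple.gen F x := by
  intro h
  exact hx c (by simpa using congrArg (algebraMap F⟮x⟯ E) h)

/-- square classes in quadratic extension -/
theorem sq_quad {F E : Type*} [Field F] [Field E] [Algebra F E] (h2 : (2 : F) ≠ 0)
    (hfr : Module.finrank F E = 2) (x : E) (hx : ∀ c : F, algebraMap F E c ≠ x)
    (a : F) (ha : x ^ 2 = algebraMap F E a) (b : F) (hb : IsSquare (algebraMap F E b)) :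
    IsSquare b ∨ IsSquare (b * a) := by
  obtain ⟨z, hz⟩ := hb
  obtain ⟨p, q, rfl⟩ := quad_repr hfr x hx z
  have key : algebraMap F E (b - p ^ 2 - q ^ 2 * a) = algebraMap F E (2 * p * q) * x := by
    simp only [map_sub, map_mul, map_pow, hz, ← ha, map_ofNat]; ring
  have h0 : 2 * p * q = 0 := by
    by_contra hne
    apply hx ((b - p ^ 2 - q ^ 2 * a) / (2 * p * q))
    rw [map_div₀, key, mul_div_cancel_left₀]
    simpa using hne
  have hb : b = p ^ 2 + q ^ 2 * a := by
    have : algebraMap F E (b - p ^ 2 - q ^ 2 * a) = 0 := by rw [key, h0]; simp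
    have := (map_eq_zero _).1 this
    linear_combination this
  rcases mul_eq_zero.1 h0 with h | h
  · have hp : p = 0 := by simpa [h2] using h
    right; exact ⟨q * a, by rw [hb, hp]; ring⟩
  · left; exact ⟨p, by rw [hb, h]; ring⟩

/-- norm from an extension containing √a has the form A² - aB² -/
theorem norm_form {F L : Type*} [Field F] [Field L] [Algebra F L] [FiniteDimensional F L]
    (h2 : (2 : F) ≠ 0) (a : F) (ha0 : a ≠ 0) (x : L) (ha : x ^ 2 = algebraMap F L a) (y : L) :
    ∃ A B : F, Algebra.norm F y = A ^ 2 - a * B ^ 2 := by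
  by_cases hx : ∃ c : F, algebraMap F L c = x
  · obtain ⟨c, rfl⟩ := hx
    have hc : c ^ 2 = a := (algebraMap F L).injective (by simpa using ha)
    subst hc
    have hc0 : c ≠ 0 := by rintro rfl; simp at ha0
    refine ⟨(Algebra.norm F y + 1) / 2, (Algebra.norm F y - 1) / (2 * c), ?_⟩
    field_simp
    ring
  · push Not at hx
    rw [← Algebra.norm_norm (S := F⟮x⟯)]
    obtain ⟨p, q, h⟩ := quad_repr (finrank_adj x hx a ha) _ (gen_ne x hx)
      (Algebra.norm F⟮x⟯ y)
    refine ⟨p, q, ?_⟩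
    rw [h, quad_norm (finrank_adj x hx a ha) _ (gen_ne x hx) a]
    apply (algebraMap F⟮x⟯ L).injective
    simpa using ha

/-- `4 ∣ [κ : k]` -/
theorem four_dvd {k κ : Type*} [Field k] [Field κ] [Algebra k κ] [FiniteDimensional k κ]
    (h2 : (2 : k) ≠ 0) (a₁ a₂ : k)
    (hns : ¬ IsSquare a₁ ∧ ¬ IsSquare a₂ ∧ ¬ IsSquare (a₁ * a₂))
    (s1 : IsSquare (algebraMap k κ a₁)) (s2 : IsSquare (algebraMap k κ a₂)) :
    4 ∣ Module.finrank k κ := by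
  obtain ⟨x, hx⟩ := s1
  obtain ⟨y, hy⟩ := s2
  have hxn : ∀ c : k, algebraMap k κ c ≠ x := by
    rintro c rfl
    exact hns.1 ⟨c, (algebraMap k κ).injective (by simpa using hx)⟩
  have hfx := finrank_adj x hxn a₁ (by rw [hx, sq])
  have hyn : ∀ c : k⟮x⟯, algebraMap k⟮x⟯ κ c ≠ y := by
    intro c hc
    have := sq_quad h2 hfx _ (gen_ne x hxn) a₁ (by
      apply (algebraMap k⟮x⟯ κ).injective
      simp [hx, sq]) a₂ ⟨c, by
        apply (algebraMap k⟮x⟯ κ).injective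
        rw [map_mul, hc, ← hy]; rfl⟩
    rcases this with h | h
    · exact hns.2.1 h
    · exact hns.2.2 (by rwa [mul_comm])
  have hfy := finrank_adj (F := k⟮x⟯) y hyn (algebraMap k _ a₂) (by rw [sq, ← hy]; rfl)
  have e1 := Module.finrank_mul_finrank k k⟮x⟯ κ
  have e2 := Module.finrank_mul_finrank k⟮x⟯ k⟮x⟯⟮y⟯ κ
  rw [hfx] at e1
  rw [hfy] at e2
  exact ⟨Module.finrank k⟮x⟯⟮y⟯ κ, by rw [← e1, ← e2]; ring⟩

theorem tower {K Ω ι : Type*} [Field K] [Field Ω] [Algebra K Ω] [DecidableEq ι]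
    (h2 : (2 : K) ≠ 0) (a : ι → K) (x : ι → Ω) (hx : ∀ i, x i ^ 2 = algebraMap K Ω (a i))
    (hind : ∀ T : Finset ι, T.Nonempty → ¬ IsSquare (∏ i ∈ T, a i)) (S : Finset ι) :
    Module.finrank K (adjoin K (x '' (S : Set ι))) = 2 ^ S.card ∧
    ∀ b : K, ∀ z ∈ adjoin K (x '' (S : Set ι)), z ^ 2 = algebraMap K Ω b →
      ∃ T ⊆ S, IsSquare (b * ∏ i ∈ T, a i) := by
  induction S using Finset.induction_on with
  | empty =>
    constructor
    · simp
    · intro b z hz hzb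
      simp only [Finset.coe_empty, Set.image_empty, adjoin_empty, mem_bot] at hz
      obtain ⟨c, rfl⟩ := hz
      refine ⟨∅, le_rfl, c, (algebraMap K Ω).injective ?_⟩
      simp [← hzb, sq]
  | insert i S hi ih =>
    obtain ⟨ih1, ih2⟩ := ih
    set F := adjoin K (x '' (S : Set ι)) with hF
    have hadj : adjoin K (x '' ((insert i S : Finset ι) : Set ι)) = F⟮x i⟯.restrictScalars K := by
      rw [Finset.coe_insert, Set.image_insert_eq, hF, adjoin_adjoin_left, Set.union_singleton]
    have hxi : ∀ c : F, algebraMap F Ω c ≠ x i := by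
      intro c hc
      obtain ⟨T, hT, hsq⟩ := ih2 (a i) (x i) (by rw [← hc]; exact c.2) (hx i)
      have : i ∉ T := fun h => hi (hT h)
      apply hind (insert i T) (Finset.insert_nonempty _ _)
      rwa [Finset.prod_insert this]
    have hsqF : x i ^ 2 = algebraMap F Ω (algebraMap K F (a i)) := hx i
    have hfr := finrank_adj (F := F) (x i) hxi _ hsqF
    rw [hadj]
    constructor
    · change Module.finrank K F⟮x i⟯ = _
      rw [← Module.finrank_mul_finrank K F F⟮x i⟯, hfr, ih1, Finset.card_insert_of_notMem hi,
        pow_succ]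
    · intro b z hz hzb
      have h2F : (2 : F) ≠ 0 := by
        have := (map_ne_zero (algebraMap K F)).2 h2
        rwa [map_ofNat] at this
      have := sq_quad h2F hfr _ (gen_ne (x i) hxi) (algebraMap K F (a i)) (by
        apply (algebraMap F⟮x i⟯ Ω).injective
        simpa using hsqF) (algebraMap K F b) ⟨⟨z, hz⟩, by
        apply (algebraMap F⟮x i⟯ Ω).injective
        rw [← sq, map_pow]
        exact hzb.symm⟩
      rcases this with ⟨c, hc⟩ | ⟨c, hc⟩
      · obtain ⟨T, hT, hsq⟩ := ih2 b c c.2 (by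
          have := congrArg (algebraMap F Ω) hc
          rw [map_mul, ← sq] at this
          exact this.symm)
        exact ⟨T, hT.trans (Finset.subset_insert _ _), hsq⟩
      · obtain ⟨T, hT, hsq⟩ := ih2 (b * a i) c c.2 (by
          have := congrArg (algebraMap F Ω) hc
          rw [← map_mul (algebraMap K F), ← sq, map_pow] at this
          exact this.symm)
        have : i ∉ T := fun h => hi (hT h)
        refine ⟨insert i T, Finset.insert_subset_insert _ hT, ?_⟩
        rwa [Finset.prod_insert this, ← mul_assoc]

theorem multiquad {K Ω ι : Type} [Field K] [Field Ω] [Algebra K Ω] [Fintype ι]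
    (h2 : (2 : K) ≠ 0) (a : ι → K) (ha0 : ∀ i, a i ≠ 0) (x : ι → Ω)
    (hx : ∀ i, x i ^ 2 = algebraMap K Ω (a i)) :
    FiniteDimensional K (adjoin K (Set.range x)) ∧ IsGalois K (adjoin K (Set.range x)) ∧
      ∀ σ : (adjoin K (Set.range x)) ≃ₐ[K] (adjoin K (Set.range x)), σ * σ = 1 := by
  have hmon : ∀ i, (X ^ 2 - C (a i) : K[X]).Monic := fun i => monic_X_pow_sub_C _ two_ne_zero
  have hint : ∀ i, IsIntegral K (x i) := fun i => ⟨X ^ 2 - C (a i), hmon i, by simp [hx i]⟩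
  have hfd : FiniteDimensional K (adjoin K (Set.range x)) := by
    have := Set.finite_range x
    apply IntermediateField.finiteDimensional_adjoin
    rintro _ ⟨i, rfl⟩
    exact hint i
  have hrs : adjoin K ((∏ i, (X ^ 2 - C (a i) : K[X])).rootSet Ω) = adjoin K (Set.range x) := by
    apply le_antisymm
    · rw [adjoin_le_iff]
      intro z hz
      have hz := aeval_eq_zero_of_mem_rootSet hz
      rw [map_prod, Finset.prod_eq_zero_iff] at hz
      obtain ⟨i, -, hi⟩ := hz
      have hi' : z ^ 2 = x i ^ 2 := by
        rw [hx i]; simpa [sub_eq_zero] using hi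
      have hm : x i ∈ adjoin K (Set.range x) := subset_adjoin _ _ ⟨i, rfl⟩
      rcases sq_eq_sq_iff_eq_or_eq_neg.1 hi' with h | h
      · rw [h]; exact hm
      · rw [h]; exact neg_mem hm
    · apply adjoin.mono
      rintro _ ⟨i, rfl⟩
      rw [mem_rootSet]
      refine ⟨(monic_prod_of_monic _ _ fun i _ => hmon i).ne_zero, ?_⟩
      rw [map_prod, Finset.prod_eq_zero_iff]
      exact ⟨i, Finset.mem_univ _, by simp [hx i]⟩
  have hspl : ((∏ i, (X ^ 2 - C (a i) : K[X])).map (algebraMap K Ω)).Splits := by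
    rw [Polynomial.map_prod]
    apply Polynomial.Splits.prod
    intro i _
    have : (X ^ 2 - C (a i) : K[X]).map (algebraMap K Ω) = (X - C (x i)) * (X + C (x i)) := by
      simp only [Polynomial.map_sub, Polynomial.map_pow, map_X, map_C, ← hx i, C_pow]
      ring
    rw [this]
    exact (Splits.X_sub_C _).mul (Splits.X_add_C _)
  have hsep : Algebra.IsSeparable K (adjoin K (Set.range x)) := by
    rw [isSeparable_adjoin_iff_isSeparable]
    rintro _ ⟨i, rfl⟩
    have : (X ^ 2 - C (a i) : K[X]).Separable :=
      separable_X_pow_sub_C (a i) (by exact_mod_cast h2) (ha0 i)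
    exact this.of_dvd (minpoly.dvd K _ (by simp [hx i]))
  have hnorm : Normal K (adjoin K (Set.range x)) := by
    have := IntermediateField.adjoin_rootSet_isSplittingField hspl
    rw [hrs] at this
    exact Normal.of_isSplittingField (∏ i, (X ^ 2 - C (a i) : K[X]))
  refine ⟨hfd, ⟨⟩, ?_⟩
  intro σ
  have : (σ * σ).toAlgHom = (1 : (adjoin K (Set.range x)) ≃ₐ[K] (adjoin K (Set.range x))).toAlgHom := by
    apply IntermediateField.algHom_ext_of_eq_adjoin _ rfl
    rintro _ ⟨i, rfl⟩
    set g : adjoin K (Set.range x) := ⟨x i, subset_adjoin _ _ ⟨i, rfl⟩⟩ with hg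
    change σ (σ g) = g
    have hg2 : g ^ 2 = algebraMap K _ (a i) := Subtype.ext (hx i)
    have : σ g ^ 2 = g ^ 2 := by rw [← map_pow, hg2, AlgEquiv.commutes]
    rcases sq_eq_sq_iff_eq_or_eq_neg.1 this with h | h
    · rw [h, h]
    · rw [h, map_neg, h, neg_neg]
  ext z
  exact congrArg Subtype.val (DFunLike.congr_fun this z)

/-- quadratic extensions are generated by a square root -/
theorem quad_gen {F E : Type*} [Field F] [Field E] [Algebra F E] (h2 : (2 : F) ≠ 0)
    (hfr : Module.finrank F E = 2) :
    ∃ (e : E) (b : F), (∀ c : F, algebraMap F E c ≠ e) ∧ e ^ 2 = algebraMap F E b := by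
  have : ∃ z : E, ∀ c : F, algebraMap F E c ≠ z := by
    by_contra! h
    have : (⊥ : Subalgebra F E) = ⊤ := by
      rw [eq_top_iff]; intro z _
      exact Algebra.mem_bot.2 (h z)
    rw [Subalgebra.bot_eq_top_iff_finrank_eq_one] at this
    omega
  obtain ⟨z, hz⟩ := this
  obtain ⟨p, q, h⟩ := quad_repr hfr z hz (z ^ 2)
  refine ⟨z - algebraMap F E (q / 2), p + (q / 2) ^ 2, ?_, ?_⟩
  · intro c hc
    exact hz (c + q / 2) (by rw [map_add, hc]; ring)
  · have : (2 : E) ≠ 0 := by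
      have := (map_ne_zero (algebraMap F E)).2 h2
      rwa [map_ofNat] at this
    rw [sub_sq, h]
    simp only [map_div₀, map_add, map_pow, map_ofNat]
    field_simp
    ring

/-- being a norm of quadratic form `⟨1,-d⟩` -/
theorem rep_prod {K ι : Type*} [Field K] (d : K) (a : ι → K)
    (ha : ∀ i, ∃ m n : K, a i = m ^ 2 - d * n ^ 2) (T : Finset ι) :
    ∃ m n : K, ∏ i ∈ T, a i = m ^ 2 - d * n ^ 2 := by
  classical
  induction T using Finset.induction_on with
  | empty => exact ⟨1, 0, by simp⟩
  | insert i T hi ih =>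
    obtain ⟨m, n, h⟩ := ih
    obtain ⟨m', n', h'⟩ := ha i
    refine ⟨m * m' + d * n * n', m * n' + m' * n, ?_⟩
    rw [Finset.prod_insert hi, h, h']; ring

theorem d_norm {K E ι : Type} [Field K] [Field E] [Algebra K E] (h2 : (2 : K) ≠ 0)
    (hfr : Module.finrank K E = 2) (d : K) (hd0 : d ≠ 0) (a : ι → K) (ha0 : ∀ i, a i ≠ 0)
    (ha : ∀ i, ∃ m n : K, a i = m ^ 2 - d * n ^ 2)
    (hsq : ∀ b : K, IsSquare (algebraMap K E b) → ∃ T : Finset ι, IsSquare (b * ∏ i ∈ T, a i)) :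
    ∃ y : E, y ≠ 0 ∧ Algebra.norm K y = d := by
  obtain ⟨e, b, he, heb⟩ := quad_gen h2 hfr
  obtain ⟨T, c, hc⟩ := hsq b ⟨e, by rw [← heb, sq]⟩
  obtain ⟨m, n, hmn⟩ := rep_prod d a ha T
  have hP : ∏ i ∈ T, a i ≠ 0 := Finset.prod_ne_zero_iff.2 fun i _ => ha0 i
  set P := ∏ i ∈ T, a i with hPdef
  have hb : b = (c * m / P) ^ 2 - d * (c * n / P) ^ 2 := by
    have : b = c * c / P := by rw [← hc]; field_simp
    rw [this, div_pow, div_pow, mul_pow, mul_pow]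
    field_simp
    rw [hmn]
  set M := c * m / P
  set N := c * n / P
  have hN : N ≠ 0 := by
    intro h0
    rw [h0] at hb
    have : e ^ 2 = (algebraMap K E M) ^ 2 := by rw [heb, hb]; simp
    rcases sq_eq_sq_iff_eq_or_eq_neg.1 this with h | h
    · exact he M h.symm
    · exact he (-M) (by rw [map_neg, h])
  have hn : Algebra.norm K (algebraMap K E (M / N) + algebraMap K E (1 / N) * e) = d := by
    rw [quad_norm hfr e he b heb, hb]
    field_simp
    ring
  refine ⟨_, ?_, hn⟩
  intro h0
  rw [h0] at hn
  have : FiniteDimensional K E := FiniteDimensional.of_finrank_eq_succ hfr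
  rw [Algebra.norm_zero] at hn
  exact hd0 hn.symm

theorem sq_mod {k : Type*} [Field k] (a : k) (f P : k[X]) (hf : Squarefree f)
    (hP : Irreducible P) (hPf : P ∣ f) :
    ∀ (N : ℕ) (h A B : k[X]), h.natDegree ≤ N → h ≠ 0 → h ^ 2 * f = A ^ 2 - C a * B ^ 2 →
      IsSquare (algebraMap k (AdjoinRoot P) a) := by
  have hPd : 0 < P.natDegree := hP.natDegree_pos
  intro N
  induction N with
  | zero =>
    intro h A B hN h0 e
    have : Fact (Irreducible P) := ⟨hP⟩
    by_cases hB : P ∣ B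
    · exfalso
      have hA : P ∣ A := by
        apply hP.prime.dvd_of_dvd_pow (n := 2)
        have : A ^ 2 = h ^ 2 * f + C a * B ^ 2 := by rw [e]; ring
        rw [this]
        exact dvd_add (hPf.mul_left _) ((dvd_pow hB two_ne_zero).mul_left _)
      have hPP : P * P ∣ h ^ 2 * f := by
        rw [e, ← sq]
        exact dvd_sub (pow_dvd_pow_of_dvd hA 2) ((pow_dvd_pow_of_dvd hB 2).mul_left _)
      have hdvd := hf.dvd_of_squarefree_of_mul_dvd_mul_left hPP
      have := natDegree_le_of_dvd (hP.prime.dvd_of_dvd_pow hdvd) h0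
      omega
    · have hmB : AdjoinRoot.mk P B ≠ 0 := by rwa [Ne, AdjoinRoot.mk_eq_zero]
      have h1 : AdjoinRoot.mk P (h ^ 2 * f) = 0 := by
        rw [AdjoinRoot.mk_eq_zero]; exact hPf.mul_left _
      rw [e, map_sub, map_mul, map_pow, map_pow, AdjoinRoot.mk_C] at h1
      refine ⟨AdjoinRoot.mk P A / AdjoinRoot.mk P B, ?_⟩
      rw [AdjoinRoot.algebraMap_eq]
      field_simp
      linear_combination -h1
  | succ N ih =>
    intro h A B hN h0 e
    have : Fact (Irreducible P) := ⟨hP⟩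
    by_cases hB : P ∣ B
    · have hA : P ∣ A := by
        apply hP.prime.dvd_of_dvd_pow (n := 2)
        have : A ^ 2 = h ^ 2 * f + C a * B ^ 2 := by rw [e]; ring
        rw [this]
        exact dvd_add (hPf.mul_left _) ((dvd_pow hB two_ne_zero).mul_left _)
      have hPP : P * P ∣ h ^ 2 * f := by
        rw [e, ← sq]
        exact dvd_sub (pow_dvd_pow_of_dvd hA 2) ((pow_dvd_pow_of_dvd hB 2).mul_left _)
      have hdvd := hf.dvd_of_squarefree_of_mul_dvd_mul_left hPP
      obtain ⟨h', rfl⟩ := hP.prime.dvd_of_dvd_pow hdvd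
      obtain ⟨A', rfl⟩ := hA
      obtain ⟨B', rfl⟩ := hB
      have h'0 : h' ≠ 0 := right_ne_zero_of_mul h0
      apply ih h' A' B' _ h'0
      · have : P ^ 2 ≠ 0 := pow_ne_zero _ hP.ne_zero
        apply mul_left_cancel₀ this
        linear_combination e
      · rw [natDegree_mul hP.ne_zero h'0] at hN
        omega
    · have hmB : AdjoinRoot.mk P B ≠ 0 := by rwa [Ne, AdjoinRoot.mk_eq_zero]
      have h1 : AdjoinRoot.mk P (h ^ 2 * f) = 0 := by
        rw [AdjoinRoot.mk_eq_zero]; exact hPf.mul_left _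
      rw [e, map_sub, map_mul, map_pow, map_pow, AdjoinRoot.mk_C] at h1
      refine ⟨AdjoinRoot.mk P A / AdjoinRoot.mk P B, ?_⟩
      rw [AdjoinRoot.algebraMap_eq]
      field_simp
      linear_combination -h1

theorem four_dvd_poly {k : Type*} [Field k] (f : k[X]) (hf0 : f ≠ 0)
    (hf : ∀ P, Irreducible P → P ∣ f → 4 ∣ P.natDegree) : 4 ∣ f.natDegree := by
  induction f using WfDvdMonoid.induction_on_irreducible with
  | zero => exact absurd rfl hf0
  | unit u hu => rw [natDegree_eq_zero_of_isUnit hu]; exact dvd_zero _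
  | mul a i ha hi ih =>
    rw [natDegree_mul hi.ne_zero ha]
    exact dvd_add (hf i hi (dvd_mul_right _ _)) (ih ha fun P hP h => hf P hP (h.mul_left _))

/-- `u ^ n * f (D / u)` -/
noncomputable def sharp {k : Type*} [Field k] (D : k) (f : k[X]) : k[X] :=
  reflect f.natDegree (f.comp (C D * X))

theorem sharp_eval {k R : Type*} [Field k] [Field R] (i : k →+* R) (D : k) (f : k[X]) (y : R)
    (hy : y ≠ 0) : eval₂ i y (sharp D f) = y ^ f.natDegree * eval₂ i (i D / y) f := by
  let _ : Invertible y⁻¹ := invertibleOfNonzero (inv_ne_zero hy)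
  have h := eval₂_reflect_mul_pow i y⁻¹ f.natDegree (f.comp (C D * X)) (by
    refine natDegree_comp_le.trans ?_
    calc _ ≤ f.natDegree * 1 := Nat.mul_le_mul_left _ (((natDegree_C_mul_le _ _).trans natDegree_X_le))
      _ = _ := mul_one _)
  rw [invOf_eq_inv, inv_inv, eval₂_comp] at h
  simp only [eval₂_mul, eval₂_C, eval₂_X] at h
  rw [div_eq_mul_inv, ← h, sharp, inv_pow]
  field_simp

theorem core_poly {k : Type*} [Field k] (D : k) (hD0 : D ≠ 0) (hD : ¬ IsSquare D)
    (f : k[X]) (hf : Squarefree f) (hf0 : f ≠ 0)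
    (h4 : ∀ P, Irreducible P → P ∣ f → 4 ∣ P.natDegree) (S : k[X])
    (hS : f * sharp D f = C D * S ^ 2) : False := by
  obtain ⟨m, hm⟩ := four_dvd_poly f hf0 h4
  have hc0 : (sharp D f).coeff 0 = f.leadingCoeff * D ^ f.natDegree := by
    rw [sharp, coeff_reflect, revAt_zero, comp_C_mul_X_coeff]; rfl
  have hcn : (sharp D f).coeff f.natDegree = f.coeff 0 := by
    rw [sharp, coeff_reflect, revAt_le le_rfl, Nat.sub_self, comp_C_mul_X_coeff]; simp
  have hlc : f.leadingCoeff ≠ 0 := leadingCoeff_ne_zero.2 hf0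
  have hs0 : sharp D f ≠ 0 := by
    intro h
    rw [h, coeff_zero] at hc0
    exact mul_ne_zero hlc (pow_ne_zero _ hD0) hc0.symm
  have hsd : (sharp D f).natDegree ≤ f.natDegree := by
    rw [sharp]
    refine natDegree_reflect_le.trans (max_le le_rfl ?_)
    refine natDegree_comp_le.trans ?_
    calc _ ≤ f.natDegree * 1 := Nat.mul_le_mul_left _ (((natDegree_C_mul_le _ _).trans natDegree_X_le))
      _ = _ := mul_one _
  have hfS : f ∣ S := by
    rw [← hf.dvd_pow_iff_dvd two_ne_zero]
    have : f ∣ C D * S ^ 2 := ⟨_, hS.symm⟩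
    exact (isUnit_C.2 (isUnit_iff_ne_zero.2 hD0)).dvd_mul_left.1 this
  obtain ⟨μ, rfl⟩ := hfS
  have hsh : sharp D f = C D * μ ^ 2 * f := by
    apply mul_left_cancel₀ hf0
    rw [hS]; ring
  have hμ0 : μ ≠ 0 := by rintro rfl; apply hs0; rw [hsh]; simp
  have hμd : μ.natDegree = 0 := by
    rw [hsh, natDegree_mul (mul_ne_zero (C_ne_zero.2 hD0) (pow_ne_zero _ hμ0)) hf0,
      natDegree_C_mul hD0, natDegree_pow] at hsd
    omega
  obtain ⟨ν, rfl⟩ := natDegree_eq_zero.1 hμd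
  have hν0 : ν ≠ 0 := by rintro rfl; simp at hμ0
  have hsh' : sharp D f = C (D * ν ^ 2) * f := by rw [hsh]; simp
  rw [hsh', coeff_C_mul] at hc0 hcn
  have e1 : (D * ν ^ 2) * (D * ν ^ 2) = (D ^ (2 * m)) * (D ^ (2 * m)) := by
    apply mul_right_cancel₀ hlc
    rw [coeff_natDegree] at hcn
    rw [hm] at hc0
    calc _ = (D * ν ^ 2) * (D * ν ^ 2 * f.leadingCoeff) := by ring
      _ = f.leadingCoeff * D ^ (4 * m) := by rw [hcn, hc0]
      _ = _ := by ring
  rcases mul_self_eq_mul_self_iff.1 e1 with h | h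
  · apply hD
    refine ⟨D ^ m / ν, ?_⟩
    field_simp
    rw [h]; ring
  · obtain ⟨ρ, hρ⟩ := IsAlgClosed.exists_pow_nat_eq (algebraMap k (AlgebraicClosure k) D) two_pos
    have hiD : algebraMap k (AlgebraicClosure k) D ≠ 0 := (_root_.map_ne_zero _).2 hD0
    have hρ0 : ρ ≠ 0 := by rintro rfl; apply hiD; rw [← hρ]; simp
    have ev := sharp_eval (algebraMap k (AlgebraicClosure k)) D f ρ hρ0
    have hdiv : algebraMap k (AlgebraicClosure k) D / ρ = ρ := by
      rw [← hρ]; field_simp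
    rw [hdiv, hsh', eval₂_mul, eval₂_C, h, hm, map_neg, map_pow, ← hρ] at ev
    have h2ne : (2 : AlgebraicClosure k) ≠ 0 ∨ (2 : AlgebraicClosure k) = 0 := (em _).symm
    have hr : eval₂ (algebraMap k (AlgebraicClosure k)) ρ f = 0 := by
      rcases h2ne with h2 | h2
      · have : 2 * ρ ^ (4 * m) * eval₂ (algebraMap k (AlgebraicClosure k)) ρ f = 0 := by
          linear_combination -ev
        simpa [h2, hρ0] using this
      · exfalso
        have h2' : (2 : k) = 0 := by
          apply (algebraMap k (AlgebraicClosure k)).injective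
          rw [map_ofNat, map_zero, h2]
        apply hD
        refine ⟨D ^ m / ν, ?_⟩
        field_simp
        rw [h]
        linear_combination (- D ^ (2 * m)) * h2'
    have hint : IsIntegral k ρ := Algebra.IsIntegral.isIntegral ρ
    have hd := h4 _ (minpoly.irreducible hint) (minpoly.dvd k ρ hr)
    have hpos := minpoly.natDegree_pos hint
    have hle := natDegree_le_of_dvd (minpoly.dvd k ρ (p := X ^ 2 - C D) (by simp [hρ]))
      (monic_X_pow_sub_C D two_ne_zero).ne_zero
    rw [natDegree_X_pow_sub_C] at hle
    have := Nat.le_of_dvd hpos hd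
    omega

theorem exists_sqfree {k : Type*} [Field k] (G : RatFunc k) (hG : G ≠ 0) :
    ∃ (f : k[X]) (H : RatFunc k), f ≠ 0 ∧ H ≠ 0 ∧ algebraMap k[X] (RatFunc k) f = G * H ^ 2 ∧
      Squarefree f := by
  classical
  have hex : ∃ n, ∃ (f : k[X]) (H : RatFunc k), f ≠ 0 ∧ H ≠ 0 ∧
      algebraMap k[X] (RatFunc k) f = G * H ^ 2 ∧ f.natDegree = n := by
    have hd : algebraMap k[X] (RatFunc k) G.denom ≠ 0 := RatFunc.algebraMap_ne_zero G.denom_ne_zero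
    refine ⟨_, G.num * G.denom, algebraMap _ _ G.denom,
      mul_ne_zero (RatFunc.num_ne_zero hG) G.denom_ne_zero, hd, ?_, rfl⟩
    have eG := RatFunc.num_div_denom G
    rw [div_eq_iff hd] at eG
    rw [map_mul, eG]
    ring
  obtain ⟨f, H, hf0, hH0, e, hn⟩ := Nat.find_spec hex
  refine ⟨f, H, hf0, hH0, e, ?_⟩
  rintro x ⟨g, rfl⟩
  have hx0 : x ≠ 0 := by rintro rfl; simp at hf0
  have hg0 : g ≠ 0 := right_ne_zero_of_mul hf0
  have hx0' : algebraMap k[X] (RatFunc k) x ≠ 0 := RatFunc.algebraMap_ne_zero hx0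
  have hle := Nat.find_min' hex ⟨g, H / algebraMap _ _ x, hg0, div_ne_zero hH0 hx0', by
    rw [map_mul, map_mul] at e
    rw [div_pow]
    field_simp
    linear_combination e, rfl⟩
  rw [← hn, natDegree_mul (mul_ne_zero hx0 hx0) hg0, natDegree_mul hx0 hx0] at hle
  have : x.natDegree = 0 := by omega
  rw [Polynomial.isUnit_iff_degree_eq_zero, degree_eq_natDegree hx0, this]
  rfl

theorem clear_denom {k : Type*} [Field k] (a : k) (f : k[X]) (A B : RatFunc k)
    (e : algebraMap k[X] (RatFunc k) f = A ^ 2 - RatFunc.C a * B ^ 2) :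
    ∃ h A' B' : k[X], h ≠ 0 ∧ h ^ 2 * f = A' ^ 2 - C a * B' ^ 2 := by
  refine ⟨A.denom * B.denom, A.num * B.denom, B.num * A.denom,
    mul_ne_zero A.denom_ne_zero B.denom_ne_zero, ?_⟩
  apply RatFunc.algebraMap_injective k
  have hA : algebraMap k[X] (RatFunc k) A.denom ≠ 0 := RatFunc.algebraMap_ne_zero A.denom_ne_zero
  have hB : algebraMap k[X] (RatFunc k) B.denom ≠ 0 := RatFunc.algebraMap_ne_zero B.denom_ne_zero
  have eA := RatFunc.num_div_denom A
  have eB := RatFunc.num_div_denom B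
  rw [div_eq_iff hA] at eA
  rw [div_eq_iff hB] at eB
  simp only [map_mul, map_pow, map_sub, e, RatFunc.algebraMap_C, eA, eB]
  ring

theorem core_rat {k : Type} [Field k] (h2 : (2 : k) ≠ 0) (a₁ a₂ : k)
    (hns : ¬ IsSquare a₁ ∧ ¬ IsSquare a₂ ∧ ¬ IsSquare (a₁ * a₂))
    (D : k) (hD0 : D ≠ 0) (hD : ¬ IsSquare D)
    (σ : RatFunc k →+* RatFunc k) (hσC : ∀ c, σ (RatFunc.C c) = RatFunc.C c)
    (hσX : σ RatFunc.X = RatFunc.C D / RatFunc.X)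
    (G : RatFunc k) (hG : G ≠ 0) (s : RatFunc k) (hs : G * σ G = RatFunc.C D * s ^ 2)
    (A₁ B₁ A₂ B₂ : RatFunc k) (e₁ : G = A₁ ^ 2 - RatFunc.C a₁ * B₁ ^ 2)
    (e₂ : G = A₂ ^ 2 - RatFunc.C a₂ * B₂ ^ 2) : False := by
  obtain ⟨f, H, hf0, hH0, e, hsf⟩ := exists_sqfree G hG
  obtain ⟨h₁, A₁', B₁', hh₁, e₁'⟩ := clear_denom a₁ f (A₁ * H) (B₁ * H) (by rw [e, e₁]; ring)
  obtain ⟨h₂, A₂', B₂', hh₂, e₂'⟩ := clear_denom a₂ f (A₂ * H) (B₂ * H) (by rw [e, e₂]; ring)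
  have h4 : ∀ P, Irreducible P → P ∣ f → 4 ∣ P.natDegree := by
    intro P hP hPf
    have : Fact (Irreducible P) := ⟨hP⟩
    have : FiniteDimensional k (AdjoinRoot P) := (AdjoinRoot.powerBasis hP.ne_zero).finite
    have := four_dvd h2 a₁ a₂ hns (sq_mod a₁ f P hsf hP hPf _ h₁ A₁' B₁' le_rfl hh₁ e₁')
      (sq_mod a₂ f P hsf hP hPf _ h₂ A₂' B₂' le_rfl hh₂ e₂')
    rwa [(AdjoinRoot.powerBasis hP.ne_zero).finrank, AdjoinRoot.powerBasis_dim] at this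
  obtain ⟨m, hm⟩ := four_dvd_poly f hf0 h4
  have hX : (RatFunc.X : RatFunc k) ≠ 0 := RatFunc.X_ne_zero
  have hev : ∀ p : k[X], algebraMap k[X] (RatFunc k) p = eval₂ RatFunc.C RatFunc.X p := by
    intro p
    rw [← RatFunc.aeval_X_left_eq_algebraMap]; rfl
  have hσf : σ (algebraMap k[X] (RatFunc k) f) = eval₂ RatFunc.C (RatFunc.C D / RatFunc.X) f := by
    rw [hev, hom_eval₂, hσX]
    congr 1
    ext c
    exact hσC c
  have hsharp : algebraMap k[X] (RatFunc k) (sharp D f) =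
      RatFunc.X ^ (4 * m) * σ (algebraMap k[X] (RatFunc k) f) := by
    rw [hev, sharp_eval _ _ _ _ hX, hσf, hm]
  have hCD : (RatFunc.C D : RatFunc k) ≠ 0 := (_root_.map_ne_zero _).2 hD0
  have hsq : (RatFunc.X ^ (2 * m) * (s * H * σ H)) ^ 2 =
      algebraMap k[X] (RatFunc k) (C D⁻¹ * (f * sharp D f)) := by
    rw [map_mul, map_mul, hsharp, e, map_mul, map_pow, RatFunc.algebraMap_C, map_inv₀]
    field_simp
    linear_combination (-(RatFunc.X ^ (4 * m)) * σ H ^ 2) * hs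
  obtain ⟨S, hS⟩ := IsIntegrallyClosedIn.exists_algebraMap_eq_of_isIntegral_pow (R := k[X])
    (x := (RatFunc.X ^ (2 * m) * (s * H * σ H))) two_pos (by rw [hsq]; exact isIntegral_algebraMap)
  rw [← hS, ← map_pow] at hsq
  have hsq' := RatFunc.algebraMap_injective k hsq
  apply core_poly D hD0 hD f hsf hf0 h4 S
  rw [hsq', ← mul_assoc, ← C_mul, mul_inv_cancel₀ hD0, C_1, one_mul]

theorem exists_hom {k : Type} [Field k] (z : RatFunc k) (hz : ¬ ∃ c, z = RatFunc.C c) :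
    ∃ σ : RatFunc k →+* RatFunc k, (∀ c, σ (RatFunc.C c) = RatFunc.C c) ∧ σ RatFunc.X = z := by
  have ht : Transcendental k z := RatFunc.transcendental_of_ne_C _ hz
  have hinj : Function.Injective (aeval (R := k) z).toRingHom :=
    transcendental_iff_injective.1 ht
  refine ⟨RatFunc.liftRingHom (aeval (R := k) z).toRingHom
    (nonZeroDivisors_le_comap_nonZeroDivisors_of_injective _ hinj), ?_, ?_⟩
  · intro c
    rw [← RatFunc.algebraMap_C, RatFunc.liftRingHom_algebraMap]
    simp [RatFunc.algebraMap_eq_C]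
  · rw [← RatFunc.algebraMap_X, RatFunc.liftRingHom_algebraMap]
    simp

theorem hom_ext' {k : Type} [Field k] (f g : RatFunc k →+* RatFunc k)
    (hC : ∀ c, f (RatFunc.C c) = g (RatFunc.C c)) (hX : f RatFunc.X = g RatFunc.X) : f = g := by
  apply IsLocalization.ringHom_ext (nonZeroDivisors k[X])
  apply Polynomial.ringHom_ext
  · intro c; simpa using hC c
  · simpa using hX

theorem exists_homs {k : Type} [Field k] (h2 : (2 : k) ≠ 0) (D : k) (hD : D ≠ 0) :
    ∃ (σ θ : RatFunc k →+* RatFunc k) (w : RatFunc k), (∀ c, σ (RatFunc.C c) = RatFunc.C c) ∧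
      σ RatFunc.X = RatFunc.C D / RatFunc.X ∧ (∀ c, θ (RatFunc.C c) = RatFunc.C c) ∧
      w ^ 2 = θ (RatFunc.X ^ 2 - RatFunc.C D) ∧ σ w = - w ∧ ∀ f, σ (θ f) = θ f := by
  have hX : (RatFunc.X : RatFunc k) ≠ 0 := RatFunc.X_ne_zero
  have hCD : (RatFunc.C D : RatFunc k) ≠ 0 := (_root_.map_ne_zero _).2 hD
  have h2' : (2 : RatFunc k) ≠ 0 := by
    have : (RatFunc.C 2 : RatFunc k) ≠ 0 := (_root_.map_ne_zero _).2 h2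
    rwa [map_ofNat] at this
  obtain ⟨σ, hσC, hσX⟩ := exists_hom (RatFunc.C D / RatFunc.X) (by
    rintro ⟨c, hc⟩
    rw [div_eq_iff hX, ← RatFunc.algebraMap_X, ← RatFunc.algebraMap_C, ← RatFunc.algebraMap_C,
      ← map_mul] at hc
    have := congrArg (fun p => coeff p 0) (RatFunc.algebraMap_injective k hc)
    simp at this
    exact hD this)
  obtain ⟨θ, hθC, hθX⟩ := exists_hom ((RatFunc.X + RatFunc.C D / RatFunc.X) / 2) (by
    rintro ⟨c, hc⟩
    have hc' : RatFunc.X ^ 2 + RatFunc.C D = RatFunc.C c * (2 * RatFunc.X) := by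
      rw [← hc]; field_simp
    rw [← RatFunc.algebraMap_X, ← RatFunc.algebraMap_C, ← RatFunc.algebraMap_C,
      ← map_pow, ← map_add, show (2 : RatFunc k) = algebraMap k[X] (RatFunc k) 2 from (map_ofNat _ 2).symm,
      ← map_mul, ← map_mul] at hc'
    have := congrArg (fun p => eval 0 p) (RatFunc.algebraMap_injective k hc')
    simp at this
    exact hD this)
  refine ⟨σ, θ, (RatFunc.X - RatFunc.C D / RatFunc.X) / 2, hσC, hσX, hθC, ?_, ?_, ?_⟩
  · rw [map_sub, map_pow, hθX, hθC]; field_simp; ring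
  · rw [map_div₀, map_sub, map_div₀, hσX, hσC, map_ofNat]; field_simp; ring
  · intro f
    have : σ.comp θ = θ := by
      apply hom_ext'
      · intro c; simp [hθC, hσC]
      · simp only [RingHom.comp_apply, hθX]
        rw [map_div₀, map_add, map_div₀, hσX, hσC, map_ofNat]; field_simp; ring
    exact DFunLike.congr_fun this f

theorem extend_quad {F E R : Type*} [Field F] [Field E] [Field R] [Algebra F E] (x : E)
    (hx : ∀ c : F, algebraMap F E c ≠ x) (a : F) (ha : x ^ 2 = algebraMap F E a)
    (θ : F →+* R) (w : R) (hw : w ^ 2 = θ a) :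
    ∃ Θ : F⟮x⟯ →+* R, (∀ c, Θ (algebraMap F F⟮x⟯ c) = θ c) ∧ Θ (AdjoinSimple.gen F x) = w := by
  let _ := θ.toAlgebra
  have hint : IsIntegral F x := ⟨X ^ 2 - C a, monic_X_pow_sub_C _ two_ne_zero, by simp [ha]⟩
  have hmin : minpoly F x = X ^ 2 - C a := by
    symm
    refine eq_of_monic_of_dvd_of_natDegree_le (minpoly.monic hint) (monic_X_pow_sub_C _ two_ne_zero)
      (minpoly.dvd _ _ (by simp [ha])) ?_
    rw [← adjoin.finrank hint, finrank_adj x hx a ha]; simp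
  have h0 : aeval w (minpoly F (adjoin.powerBasis hint).gen) = 0 := by
    rw [adjoin.powerBasis_gen, minpoly_gen, hmin]
    simp only [map_sub, map_pow, aeval_X, aeval_C, hw]
    exact sub_self _
  refine ⟨((adjoin.powerBasis hint).lift w h0).toRingHom, fun c => ?_, ?_⟩
  · exact ((adjoin.powerBasis hint).lift w h0).commutes c
  · have := (adjoin.powerBasis hint).lift_gen w h0
    rwa [adjoin.powerBasis_gen] at this
theorem k_infinite {k : Type} [Field k] (a₁ a₂ : k)
    (hns : ¬ IsSquare a₁ ∧ ¬ IsSquare a₂ ∧ ¬ IsSquare (a₁ * a₂)) : Infinite k := by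
  classical
  by_contra hfin
  rw [not_infinite_iff_finite] at hfin
  have := Fintype.ofFinite k
  have e1 := quadraticChar_neg_one_iff_not_isSquare.2 hns.1
  have e2 := quadraticChar_neg_one_iff_not_isSquare.2 hns.2.1
  have e3 := quadraticChar_neg_one_iff_not_isSquare.2 hns.2.2
  rw [map_mul, e1, e2] at e3
  norm_num at e3

theorem exists_c {k : Type} [Field k] [Infinite k] (m : ℕ) :
    ∃ c : Fin m → k, (∀ j, c j ≠ 0) ∧ Function.Injective (fun j => c j ^ 2) := by
  have hinf : (Set.range (fun c : k => c ^ 2) \ {0}).Infinite := by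
    refine Set.Infinite.sdiff ?_ (Set.finite_singleton _)
    intro hf
    have hu : (Set.univ : Set k).Finite := by
      apply Set.Finite.subset (hf.biUnion (t := fun b => {c : k | c ^ 2 = b}) ?_)
      · intro c _
        simp only [Set.mem_iUnion]
        exact ⟨c ^ 2, ⟨c, rfl⟩, rfl⟩
      · intro b _
        apply Set.Finite.subset ((X ^ 2 - C b : k[X]).rootSet_finite k)
        intro c hc
        rw [mem_rootSet]
        refine ⟨(monic_X_pow_sub_C _ two_ne_zero).ne_zero, ?_⟩
        simp only [Set.mem_ofPred_eq] at hc
        simp [hc]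
    exact Set.infinite_univ hu
  let e := hinf.natEmbedding
  have hp : ∀ n : ℕ, ∃ c : k, c ≠ 0 ∧ c ^ 2 = (e n : k) := by
    intro n
    obtain ⟨⟨c, hc⟩, h0⟩ := (e n).2
    refine ⟨c, ?_, hc⟩
    rintro rfl
    apply h0
    rw [← hc]; simp
  choose c hc0 hc using hp
  refine ⟨fun j => c j, fun j => hc0 _, ?_⟩
  intro i j hij
  simp only [hc] at hij
  exact Fin.ext (e.injective (Subtype.ext hij))

theorem indep {k : Type} [Field k] (h2 : (2 : k) ≠ 0) (a₁ a₂ : k)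
    (hns : ¬ IsSquare a₁ ∧ ¬ IsSquare a₂ ∧ ¬ IsSquare (a₁ * a₂)) {m : ℕ} (e : Fin m → k)
    (he0 : ∀ j, e j ≠ 0) (he : Function.Injective e) (T : Finset (Fin 2 ⊕ Fin m))
    (hT : T.Nonempty) :
    ¬ IsSquare (∏ i ∈ T, (Sum.elim ![RatFunc.C a₁, RatFunc.C a₂]
      (fun j => RatFunc.X ^ 2 - RatFunc.C (e j)) i : RatFunc k)) := by
  classical
  rintro ⟨q, hq⟩
  set F : k[X] := ∏ j ∈ T.toRight, (X ^ 2 - C (e j)) with hF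
  set c : k := ∏ i ∈ T.toLeft, ![a₁, a₂] i with hc
  have hprod : (∏ i ∈ T, (Sum.elim ![RatFunc.C a₁, RatFunc.C a₂]
      (fun j => RatFunc.X ^ 2 - RatFunc.C (e j)) i : RatFunc k)) =
      algebraMap k[X] (RatFunc k) (C c * F) := by
    rw [Finset.prod_sum_eq_prod_toLeft_mul_prod_toRight, map_mul, RatFunc.algebraMap_C, hF,
      map_prod (algebraMap k[X] (RatFunc k)), hc, map_prod RatFunc.C]
    congr 1
    · apply Finset.prod_congr rfl
      intro i _
      fin_cases i <;> simp
    · apply Finset.prod_congr rfl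
      intro i _
      simp
  have ha1 : a₁ ≠ 0 := by rintro rfl; exact hns.1 (IsSquare.zero)
  have ha2 : a₂ ≠ 0 := by rintro rfl; exact hns.2.1 (IsSquare.zero)
  have hc0 : c ≠ 0 := by
    rw [hc, Finset.prod_ne_zero_iff]
    intro i _
    fin_cases i <;> simp [ha1, ha2]
  rw [hprod, ← pow_two] at hq
  obtain ⟨Q, hQ⟩ := IsIntegrallyClosedIn.exists_algebraMap_eq_of_isIntegral_pow (R := k[X])
    (x := q) two_pos (by rw [← hq]; exact isIntegral_algebraMap)
  rw [← hQ, ← map_pow] at hq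
  have hq' := RatFunc.algebraMap_injective k hq
  have hsf : Squarefree F := by
    apply Finset.squarefree_prod_of_pairwise_isCoprime
    · intro i _ j _ hij
      apply IsCoprime.isRelPrime
      have hne : e j - e i ≠ 0 := sub_ne_zero.2 fun h => hij (he h).symm
      refine ⟨C (e j - e i)⁻¹, - C (e j - e i)⁻¹, ?_⟩
      have : C (e j - e i)⁻¹ * (C (e j) - C (e i)) = 1 := by
        rw [← C_sub, ← C_mul, inv_mul_cancel₀ hne, C_1]
      linear_combination this
    · intro i _
      exact (separable_X_pow_sub_C (e i) (n := 2) (by exact_mod_cast h2) (he0 i)).squarefree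
  have hQF : Q * Q ∣ F := by
    refine ⟨C c⁻¹, ?_⟩
    rw [← pow_two, ← hq', mul_right_comm, ← C_mul, mul_inv_cancel₀ hc0, C_1, one_mul]
  obtain ⟨u, hu, rfl⟩ := Polynomial.isUnit_iff.1 (hsf Q hQF)
  have hdeg : F.natDegree = 2 * T.toRight.card := by
    rw [hF, natDegree_prod_of_monic _ _ fun j _ => monic_X_pow_sub_C _ two_ne_zero]
    simp [mul_comm]
  have hd0 : F.natDegree = 0 := by
    rw [← natDegree_C_mul hc0, hq', ← C_pow, natDegree_C]
  have hR : T.toRight = ∅ := by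
    rw [← Finset.card_eq_zero]; omega
  have hF1 : F = 1 := by rw [hF, hR]; simp
  rw [hF1, mul_one, ← C_pow] at hq'
  have hcs : c = u ^ 2 := C_injective hq'
  have hL : T.toLeft.Nonempty := by
    obtain ⟨i, hi⟩ := hT
    rcases i with i | j
    · exact ⟨i, by simpa using hi⟩
    · have : j ∈ T.toRight := by simpa using hi
      rw [hR] at this
      simp at this
  have hsqc : IsSquare c := ⟨u, by rw [hcs, pow_two]⟩
  rw [hc] at hsqc
  generalize T.toLeft = S at hL hsqc
  by_cases m0 : (0 : Fin 2) ∈ S <;> by_cases m1 : (1 : Fin 2) ∈ S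
  · have : S = {0, 1} := by ext i; fin_cases i <;> simp [m0, m1]
    rw [this, Finset.prod_pair (by decide)] at hsqc
    exact hns.2.2 hsqc
  · have : S = {0} := by ext i; fin_cases i <;> simp [m0, m1]
    rw [this, Finset.prod_singleton] at hsqc
    exact hns.1 hsqc
  · have : S = {1} := by ext i; fin_cases i <;> simp [m0, m1]
    rw [this, Finset.prod_singleton] at hsqc
    exact hns.2.1 hsqc
  · obtain ⟨i, hi⟩ := hL
    fin_cases i
    · exact m0 hi
    · exact m1 hi

theorem non_norm {k : Type} [Field k] (h2 : (2 : k) ≠ 0) (a₁ a₂ : k)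
    (hns : ¬ IsSquare a₁ ∧ ¬ IsSquare a₂ ∧ ¬ IsSquare (a₁ * a₂))
    (d c : k) (hd0 : d ≠ 0) (hd : ¬ IsSquare d) (hc : c ≠ 0)
    {L : Type} [Field L] [Algebra (RatFunc k) L] [FiniteDimensional (RatFunc k) L]
    (w : L) (hw : w ^ 2 = algebraMap (RatFunc k) L (RatFunc.X ^ 2 - RatFunc.C (d * c ^ 2)))
    (hwn : ∀ b : RatFunc k, algebraMap (RatFunc k) L b ≠ w)
    (x₁ x₂ : L) (hx₁ : x₁ ^ 2 = algebraMap (RatFunc k) L (RatFunc.C a₁))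
    (hx₂ : x₂ ^ 2 = algebraMap (RatFunc k) L (RatFunc.C a₂))
    (y : L) (hy : y ≠ 0) (s : RatFunc k) (hs : s ≠ 0)
    (e : RatFunc.C d = s ^ 2 * Algebra.norm (RatFunc k) y) : False := by
  have hD0 : d * c ^ 2 ≠ 0 := mul_ne_zero hd0 (pow_ne_zero _ hc)
  have hD : ¬ IsSquare (d * c ^ 2) := by
    rintro ⟨z, hz⟩
    refine hd ⟨z / c, ?_⟩
    field_simp
    linear_combination hz
  have ha1 : a₁ ≠ 0 := by rintro rfl; exact hns.1 (IsSquare.zero)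
  have ha2 : a₂ ≠ 0 := by rintro rfl; exact hns.2.1 (IsSquare.zero)
  obtain ⟨σ, θ, w', hσC, hσX, hθC, hw', hσw, hσθ⟩ := exists_homs h2 (d * c ^ 2) hD0
  obtain ⟨Θ, hΘ, hΘw⟩ := extend_quad w hwn _ hw θ w' hw'
  have hfr := finrank_adj w hwn _ hw
  have hgn := gen_ne w hwn
  have hgen2 : (AdjoinSimple.gen (RatFunc k) w) ^ 2 =
      algebraMap (RatFunc k) (RatFunc k)⟮w⟯ (RatFunc.X ^ 2 - RatFunc.C (d * c ^ 2)) := by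
    apply Subtype.ext
    exact hw
  have h2E : (2 : (RatFunc k)⟮w⟯) ≠ 0 := by
    have : algebraMap (RatFunc k) (RatFunc k)⟮w⟯ (RatFunc.C 2) ≠ 0 :=
      (_root_.map_ne_zero _).2 ((_root_.map_ne_zero _).2 h2)
    rwa [map_ofNat, map_ofNat] at this
  have key : ∀ a : k, a ≠ 0 → ∀ x : L, x ^ 2 = algebraMap (RatFunc k) L (RatFunc.C a) →
      ∃ A B : RatFunc k, Θ (Algebra.norm (RatFunc k)⟮w⟯ y) = A ^ 2 - RatFunc.C a * B ^ 2 := by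
    intro a ha x hx
    obtain ⟨A, B, h⟩ := norm_form h2E (algebraMap (RatFunc k) (RatFunc k)⟮w⟯ (RatFunc.C a))
      ((_root_.map_ne_zero _).2 ((_root_.map_ne_zero _).2 ha)) x hx y
    refine ⟨Θ A, Θ B, ?_⟩
    rw [h, map_sub, map_mul, map_pow, map_pow, hΘ, hθC]
  obtain ⟨A₁, B₁, e₁⟩ := key a₁ ha1 x₁ hx₁
  obtain ⟨A₂, B₂, e₂⟩ := key a₂ ha2 x₂ hx₂
  have hN : Algebra.norm (RatFunc k) (Algebra.norm (RatFunc k)⟮w⟯ y) = Algebra.norm (RatFunc k) y :=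
    Algebra.norm_norm
  have hg0 : Algebra.norm (RatFunc k)⟮w⟯ y ≠ 0 := Algebra.norm_ne_zero_iff.2 hy
  obtain ⟨p, q, hg⟩ := quad_repr hfr _ hgn (Algebra.norm (RatFunc k)⟮w⟯ y)
  have hnorm := quad_norm hfr _ hgn _ hgen2 p q
  rw [← hg, hN] at hnorm
  have hG : Θ (Algebra.norm (RatFunc k)⟮w⟯ y) = θ p + θ q * w' := by
    rw [hg, map_add, map_mul, hΘ, hΘ, hΘw]
  have hCc : (RatFunc.C c : RatFunc k) ≠ 0 := (_root_.map_ne_zero _).2 hc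
  have hθs : θ s ≠ 0 := (_root_.map_ne_zero _).2 hs
  refine core_rat h2 a₁ a₂ hns (d * c ^ 2) hD0 hD σ hσC hσX (Θ (Algebra.norm (RatFunc k)⟮w⟯ y))
    ((_root_.map_ne_zero _).2 hg0) (RatFunc.C c * θ s)⁻¹ ?_ A₁ B₁ A₂ B₂ e₁ e₂
  have h3 : Θ (Algebra.norm (RatFunc k)⟮w⟯ y) * σ (Θ (Algebra.norm (RatFunc k)⟮w⟯ y)) = θ (Algebra.norm (RatFunc k) y) := by
    rw [hG, map_add, map_mul, hσθ, hσθ, hσw, hnorm, map_sub, map_pow, map_mul, ← hw', map_pow]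
    ring
  have h4 : RatFunc.C d = θ s ^ 2 * θ (Algebra.norm (RatFunc k) y) := by
    rw [← hθC, e, map_mul, map_pow]
  rw [h3, map_mul, h4, map_pow]
  field_simp

end Aux17

set_option synthInstance.maxHeartbeats 1000000 in
/-- over `K = k(t)`, given a biquadratic extension `k(√a₁,√a₂)/k` whose
two quadratic subextensions have a common nonsquare norm, for every `r ≥ 3` there is a
multiquadratic extension `L/K` of degree `2^r`, with `a₁, a₂` squares in `L`, and
`Λ(L/K) ≠ 0`. -/
theorem stmt17 (k : Type) [Field k] (hk : (2 : k) ≠ 0)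
    (a₁ a₂ : k) (h1 : a₁ ≠ 0) (h2 : a₂ ≠ 0)
    (hns : ¬ IsSquare a₁ ∧ ¬ IsSquare a₂ ∧ ¬ IsSquare (a₁ * a₂))
    (hd : ∃ d : k, d ≠ 0 ∧ ¬ IsSquare d ∧ (∃ x y : k, d = x ^ 2 - a₁ * y ^ 2) ∧
      (∃ x y : k, d = x ^ 2 - a₂ * y ^ 2))
    (r : ℕ) (hr : 3 ≤ r) :
    ∃ L : FieldExt (RatFunc k),
      IsMultiquadratic (RatFunc k) L.carrier ∧
      Module.finrank (RatFunc k) L.carrier = 2 ^ r ∧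
      IsSquare (algebraMap (RatFunc k) L.carrier (RatFunc.C a₁)) ∧
      IsSquare (algebraMap (RatFunc k) L.carrier (RatFunc.C a₂)) ∧
      ∃ d : RatFunc k,
        (∀ E : IntermediateField (RatFunc k) L.carrier,
          Module.finrank (RatFunc k) E = 2 → d ∈ normSet (RatFunc k) E) ∧
        ¬ ∃ s : RatFunc k, s ≠ 0 ∧ ∃ y ∈ normSet (RatFunc k) L.carrier, d = s ^ 2 * y := by
  obtain ⟨d, hd0, hdns, ⟨u₁, v₁, hd1⟩, ⟨u₂, v₂, hd2⟩⟩ := hd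
  obtain ⟨m, rfl⟩ : ∃ m, r = 2 + (m + 1) := ⟨r - 3, by omega⟩
  have hinf : Infinite k := Aux17.k_infinite a₁ a₂ hns
  obtain ⟨c, hc0, hcinj⟩ := Aux17.exists_c (k := k) (m + 1)
  have he0 : ∀ j, d * c j ^ 2 ≠ 0 := fun j => mul_ne_zero hd0 (pow_ne_zero _ (hc0 j))
  have heinj : Function.Injective (fun j => d * c j ^ 2) := fun i j h =>
    hcinj (mul_left_cancel₀ hd0 h)
  have hind := Aux17.indep hk a₁ a₂ hns (fun j => d * c j ^ 2) he0 heinj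
  obtain ⟨a, ha⟩ : ∃ a : Fin 2 ⊕ Fin (m + 1) → RatFunc k, a = Sum.elim ![RatFunc.C a₁, RatFunc.C a₂]
      (fun j => RatFunc.X ^ 2 - RatFunc.C (d * c j ^ 2)) := ⟨_, rfl⟩
  rw [← ha] at hind
  have haL0 : a (Sum.inl 0) = RatFunc.C a₁ := by rw [ha]; rfl
  have haL1 : a (Sum.inl 1) = RatFunc.C a₂ := by rw [ha]; rfl
  have haR : ∀ j, a (Sum.inr j) = RatFunc.X ^ 2 - RatFunc.C (d * c j ^ 2) := by
    intro j; rw [ha]; rfl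
  clear ha
  have hk2 : (2 : RatFunc k) ≠ 0 := by
    have : (RatFunc.C 2 : RatFunc k) ≠ 0 := (map_ne_zero _).2 hk
    rwa [map_ofNat] at this
  have hasq : ∀ i, ¬ IsSquare (a i) := by
    intro i
    have := hind {i} (Finset.singleton_nonempty i)
    rwa [Finset.prod_singleton] at this
  have ha0 : ∀ i, a i ≠ 0 := by
    intro i h
    apply hasq i
    rw [h]; exact IsSquare.zero
  have hrep1 : ∀ b u v : k, d = u ^ 2 - b * v ^ 2 →
      ∃ p q : RatFunc k, RatFunc.C b = p ^ 2 - RatFunc.C d * q ^ 2 := by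
    intro b u v h
    have hv : v ≠ 0 := by
      rintro rfl
      exact hdns ⟨u, by rw [h]; ring⟩
    refine ⟨RatFunc.C (u / v), RatFunc.C (1 / v), ?_⟩
    rw [← map_pow, ← map_pow, ← map_mul, ← map_sub]
    congr 1
    field_simp
    linear_combination h
  have harep : ∀ i, ∃ p q : RatFunc k, a i = p ^ 2 - RatFunc.C d * q ^ 2 := by
    rintro (i | j)
    · fin_cases i
      · obtain ⟨p, q, h⟩ := hrep1 a₁ u₁ v₁ hd1
        exact ⟨p, q, haL0.trans h⟩
      · obtain ⟨p, q, h⟩ := hrep1 a₂ u₂ v₂ hd2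
        exact ⟨p, q, haL1.trans h⟩
    · exact ⟨RatFunc.X, RatFunc.C (c j), by rw [haR, map_mul, map_pow]⟩
  have hroot : ∀ i, ∃ z : AlgebraicClosure (RatFunc k),
      z ^ 2 = algebraMap (RatFunc k) (AlgebraicClosure (RatFunc k)) (a i) :=
    fun i => IsAlgClosed.exists_pow_nat_eq _ two_pos
  choose x hx using hroot
  obtain ⟨hFD, hGal, hσσ⟩ := Aux17.multiquad hk2 a ha0 x hx
  obtain ⟨hfr, hsq⟩ := Aux17.tower hk2 a x hx hind Finset.univ
  rw [Finset.coe_univ, Set.image_univ] at hfr hsq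
  have hCd0 : (RatFunc.C d : RatFunc k) ≠ 0 := (map_ne_zero _).2 hd0
  have hmem : ∀ i, x i ∈ IntermediateField.adjoin (RatFunc k) (Set.range x) :=
    fun i => IntermediateField.subset_adjoin _ _ ⟨i, rfl⟩
  have hmsq : ∀ i, (⟨x i, hmem i⟩ : IntermediateField.adjoin (RatFunc k) (Set.range x)) ^ 2 =
      algebraMap (RatFunc k) (IntermediateField.adjoin (RatFunc k) (Set.range x)) (a i) :=
    fun i => Subtype.ext (hx i)
  refine ⟨⟨IntermediateField.adjoin (RatFunc k) (Set.range x)⟩, ⟨hFD, hGal, hσσ⟩, ?_, ?_, ?_,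
    RatFunc.C d, ?_, ?_⟩
  · rw [hfr]; simp
  · exact ⟨⟨x (Sum.inl 0), hmem _⟩, by rw [← pow_two, ← haL0]; exact (hmsq _).symm⟩
  · exact ⟨⟨x (Sum.inl 1), hmem _⟩, by rw [← pow_two, ← haL1]; exact (hmsq _).symm⟩
  · intro E hE
    refine Aux17.d_norm hk2 hE (RatFunc.C d) hCd0 a ha0 harep ?_
    rintro b ⟨z, hz⟩
    have hz' : ((z : IntermediateField.adjoin (RatFunc k) (Set.range x)) :
        AlgebraicClosure (RatFunc k)) ^ 2 =
        algebraMap (RatFunc k) (AlgebraicClosure (RatFunc k)) b := by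
      have h1 := congrArg (fun t : E => ((t : IntermediateField.adjoin (RatFunc k) (Set.range x)) :
        AlgebraicClosure (RatFunc k))) hz
      rw [pow_two]
      exact h1.symm
    obtain ⟨T, -, hT⟩ := hsq b _ (z : IntermediateField.adjoin (RatFunc k) (Set.range x)).2 hz'
    exact ⟨T, hT⟩
  · rintro ⟨s, hs, _, ⟨y, hy, rfl⟩, e⟩
    have hw := hmsq (Sum.inr 0)
    rw [haR] at hw
    have hx1 := hmsq (Sum.inl 0)
    rw [haL0] at hx1
    have hx2 := hmsq (Sum.inl 1)
    rw [haL1] at hx2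
    refine Aux17.non_norm hk a₁ a₂ hns d (c 0) hd0 hdns (hc0 0) _ hw ?_ _ _ hx1 hx2 y hy s hs e
    intro b hb
    apply hasq (Sum.inr 0)
    refine ⟨b, ?_⟩
    rw [← hb, ← map_pow] at hw
    rw [haR, ← pow_two]
    exact (FaithfulSMul.algebraMap_injective _ _ hw).symm
end

section
/- Let k be a field with char(k) ≠ 2, n ∈ ℕ, K = k((t₁))…((tₙ)), and a₁,…,aₙ ∈ k× with [k(√a₁,…,√aₙ):k] = 2ⁿ. Let P be the set of nonempty subsets of {1,…,n}, and for I ∈ P write t_I = ∏_{i∈I} tᵢ, a_I = ∏_{i∈I} aᵢ. Define φ = ⊥_{I∈P} t_I ⟨1,-a_I⟩ over K. Then φ ⊥ H ≅ ⟨⟨-t₁,…,-tₙ⟩⟩ ⊥ -⟨⟨-a₁t₁,…,-aₙtₙ⟩⟩ (H the hyperbolic plane), so φ ∈ Iⁿ K, dim(φ) = 2^{n+1} - 2, and φ is anisotropic. -/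
open scoped TensorProduct

namespace QF

section Diag

variable {K : Type} [Field K] [Invertible (2 : K)]

/-- `φ` has an orthogonal basis whose multiset of values is `m`. -/
def HasDiag (φ : QF K) (m : Multiset K) : Prop :=
  ∃ (ι : Type) (_ : Fintype ι) (b : Module.Basis ι K φ.V),
    (∀ i j, i ≠ j → QuadraticMap.associated (R := K) φ.q (b i) (b j) = 0) ∧
      (Finset.univ : Finset ι).val.map (fun i => φ.q (b i)) = m

theorem wss_equiv_of_map_eq {ι κ : Type} [Fintype ι] [Fintype κ] (w : ι → K) (u : κ → K)
    (h : (Finset.univ : Finset ι).val.map w = (Finset.univ : Finset κ).val.map u) :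
    QuadraticMap.Equivalent (QuadraticMap.weightedSumSquares K w)
      (QuadraticMap.weightedSumSquares K u) := by
  classical
  have hc : ∀ c : K, Fintype.card {i // w i = c} = Fintype.card {j // u j = c} := by
    intro c
    have := congrArg (Multiset.count c) h
    rw [Multiset.count_map, Multiset.count_map, ← Finset.filter_val, ← Finset.filter_val,
      Finset.card_val, Finset.card_val] at this
    rw [Fintype.card_subtype, Fintype.card_subtype]
    simpa only [eq_comm] using this
  let g : ι ≃ κ := Equiv.ofFiberEquiv (f := w) (g := u) fun c => Fintype.equivOfCardEq (hc c)
  have hg : ∀ i, w i = u (g i) := fun i => (Equiv.ofFiberEquiv_map _ i).symm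
  refine ⟨⟨LinearEquiv.funCongrLeft K K g.symm, ?_⟩⟩
  intro x
  simp only [AddHom.toFun_eq_coe, LinearMap.coe_toAddHom, LinearEquiv.coe_coe,
    QuadraticMap.weightedSumSquares_apply, LinearEquiv.funCongrLeft_apply,
    LinearMap.funLeft_apply]
  rw [← Equiv.sum_comp g]
  simp [hg]

theorem HasDiag.equiv_wss {φ : QF K} {m : Multiset K} (h : HasDiag φ m)
    {κ : Type} [Fintype κ] (u : κ → K) (hu : (Finset.univ : Finset κ).val.map u = m) :
    QuadraticMap.Equivalent φ.q (QuadraticMap.weightedSumSquares K u) := by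
  obtain ⟨ι, _, b, hb, hm⟩ := h
  have h1 : QuadraticMap.Equivalent φ.q (φ.q.basisRepr b) :=
    ⟨QuadraticMap.isometryEquivBasisRepr φ.q b⟩
  rw [QuadraticMap.basisRepr_eq_of_iIsOrtho φ.q b
    (LinearMap.isOrthoᵢ_def.2 hb)] at h1
  exact h1.trans (wss_equiv_of_map_eq _ _ (hm.trans hu.symm))

theorem HasDiag.equiv {φ ψ : QF K} {m : Multiset K} (h : HasDiag φ m) (h' : HasDiag ψ m) :
    QF.Equiv φ ψ := by
  obtain ⟨ι, _, b, hb, hm⟩ := id h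
  exact (h.equiv_wss _ hm).trans (h'.equiv_wss _ hm).symm

theorem HasDiag.dim_eq {φ : QF K} {m : Multiset K} (h : HasDiag φ m) : φ.dim = m.card := by
  obtain ⟨ι, _, b, hb, hm⟩ := h
  rw [← hm]
  simpa [QF.dim] using Module.finrank_eq_card_basis b

theorem HasDiag.smul {φ : QF K} {m : Multiset K} (h : HasDiag φ m) (c : K) :
    HasDiag (QF.smul c φ) (m.map (c * ·)) := by
  obtain ⟨ι, _, b, hb, hm⟩ := h
  refine ⟨ι, inferInstance, b, ?_, ?_⟩
  · intro i j hij
    have := hb i j hij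
    change QuadraticMap.associated (R := K) (c • φ.q) (b i) (b j) = 0
    rw [map_smul]
    simp [this]
  · rw [← hm, Multiset.map_map]
    rfl

theorem HasDiag.add {φ ψ : QF K} {m m' : Multiset K} (h : HasDiag φ m) (h' : HasDiag ψ m') :
    HasDiag (QF.add φ ψ) (m + m') := by
  obtain ⟨ι, _, b, hb, hm⟩ := h
  obtain ⟨κ, _, b', hb', hm'⟩ := h'
  refine ⟨ι ⊕ κ, inferInstance, b.prod b', ?_, ?_⟩
  · intro i j hij
    change QuadraticMap.associated (R := K) (φ.q.prod ψ.q) (b.prod b' i) (b.prod b' j) = 0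
    rw [QuadraticMap.associated_prod]
    rcases i with i | i <;> rcases j with j | j
    · have : i ≠ j := fun h => hij (by rw [h])
      simp [hb i j this]
    · simp
    · simp
    · have : i ≠ j := fun h => hij (by rw [h])
      simp [hb' i j this]
  · rw [← hm, ← hm', ← Finset.univ_disjSum_univ, Finset.val_disjSum, Multiset.disjSum,
      Multiset.map_add, Multiset.map_map, Multiset.map_map]
    congr 1
    · refine Multiset.map_congr rfl fun i _ => ?_
      change (φ.q.prod ψ.q) (b.prod b' (Sum.inl i)) = _
      simp
    · refine Multiset.map_congr rfl fun i _ => ?_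
      change (φ.q.prod ψ.q) (b.prod b' (Sum.inr i)) = _
      simp

theorem HasDiag.tmul {φ ψ : QF K} {m m' : Multiset K} (h : HasDiag φ m) (h' : HasDiag ψ m') :
    HasDiag (QF.tmul φ ψ) ((m ×ˢ m').map fun p => p.1 * p.2) := by
  obtain ⟨ι, _, b, hb, hm⟩ := h
  obtain ⟨κ, _, b', hb', hm'⟩ := h'
  refine ⟨ι × κ, inferInstance, b.tensorProduct b', ?_, ?_⟩
  · rintro ⟨i, i'⟩ ⟨j, j'⟩ hij
    change QuadraticMap.associated (R := K) (QuadraticForm.tmul φ.q ψ.q)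
      ((b.tensorProduct b' : Module.Basis (ι × κ) K (φ.V ⊗[K] ψ.V)) (i, i'))
      ((b.tensorProduct b' : Module.Basis (ι × κ) K (φ.V ⊗[K] ψ.V)) (j, j')) = 0
    rw [QuadraticForm.associated_tmul]
    by_cases hh : i = j
    · have : i' ≠ j' := fun h => hij (by rw [h, hh])
      have := hb' _ _ this
      simp [this]
    · have := hb _ _ hh
      simp [this]
  · rw [← hm, ← hm', ← Finset.univ_product_univ, Finset.product_val]
    have : ∀ (s : Multiset ι) (r : Multiset κ) (f : ι → K) (g : κ → K),
        (s.map f ×ˢ r.map g).map (fun p => p.1 * p.2) =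
          (s ×ˢ r).map (fun p => f p.1 * g p.2) := by
      intro s r f g
      simp [SProd.sprod, Multiset.product, Multiset.map_bind, Multiset.bind_map, Multiset.map_map]
    rw [this]
    refine Multiset.map_congr rfl fun p _ => ?_
    change (QuadraticForm.tmul φ.q ψ.q)
      ((b.tensorProduct b' : Module.Basis (ι × κ) K (φ.V ⊗[K] ψ.V)) p) = _
    rw [Module.Basis.tensorProduct_apply' b b' p]
    refine (QuadraticForm.tensorDistrib_tmul φ.q ψ.q _ _).trans ?_
    simp [mul_comm]

theorem hasDiag_wss {n : ℕ} (w : Fin n → K) :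
    HasDiag { V := Fin n → K, q := QuadraticMap.weightedSumSquares K w }
      ((Finset.univ : Finset (Fin n)).val.map w) := by
  refine ⟨Fin n, inferInstance, Pi.basisFun K (Fin n), ?_, ?_⟩
  · intro i j hij
    change QuadraticMap.associated (R := K) (QuadraticMap.weightedSumSquares K w) _ _ = 0
    rw [QuadraticMap.associated_apply]
    simp only [QuadraticMap.weightedSumSquares_apply, ← Finset.sum_sub_distrib, Pi.basisFun_apply]
    rw [Finset.sum_eq_zero]
    · simp
    intro l _
    by_cases h1 : l = i
    · have : l ≠ j := fun h => hij (h1.symm.trans h)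
      simp [this]
    · simp [h1]
  · refine Multiset.map_congr rfl fun i _ => ?_
    change (QuadraticMap.weightedSumSquares K w) _ = _
    rw [QuadraticMap.weightedSumSquares_apply, Finset.sum_eq_single i]
    · simp
    · intro j _ hj
      simp [hj]
    · simp

theorem hasDiag_zero : HasDiag (QF.zero : QF K) 0 := by
  exact hasDiag_wss (K := K) (fun _ : Fin 0 => (1 : K))

theorem hasDiag_one : HasDiag (QF.one : QF K) {1} := by
  exact hasDiag_wss (K := K) (fun _ : Fin 1 => (1 : K))

theorem hasDiag_bin (a : K) : HasDiag (QF.bin a) {1, -a} := by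
  have := hasDiag_wss (K := K) ![1, -a]
  have h2 : (Finset.univ : Finset (Fin 2)).val.map ![1, -a] = {1, -a} := by
    rfl
  rw [h2] at this
  exact this

theorem hasDiag_sumList {ι : Type} (l : List ι) (f : ι → QF K) (m : ι → Multiset K)
    (h : ∀ i ∈ l, HasDiag (f i) (m i)) :
    HasDiag (sumList (l.map f)) ((l : Multiset ι).bind m) := by
  induction l with
  | nil => simpa [sumList] using hasDiag_zero
  | cons a l ih =>
    have h1 := h a (by simp)
    have h2 := ih (fun i hi => h i (by simp [hi]))
    rw [← Multiset.cons_coe, Multiset.cons_bind]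
    exact h1.add h2

theorem hasDiag_pfister (n : ℕ) (b : Fin n → K) :
    HasDiag (pfister (List.ofFn b))
      ((Finset.univ : Finset (Finset (Fin n))).val.map fun I => ∏ i ∈ I, -(b i)) := by
  induction n with
  | zero =>
    have : (Finset.univ : Finset (Finset (Fin 0))).val.map (fun I => ∏ i ∈ I, -(b i)) = {1} := by
      rw [show (Finset.univ : Finset (Finset (Fin 0))) = {∅} from rfl]
      simp
    rw [this]
    exact hasDiag_one
  | succ n ih =>
    rw [List.ofFn_succ]
    have h := (hasDiag_bin (b 0)).tmul (ih fun i => b i.succ)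
    change HasDiag (QF.tmul (QF.bin (b 0)) (pfister (List.ofFn fun i => b i.succ))) _
    convert h using 1
    rw [show ({1, -b 0} : Multiset K) = {1} + {-b 0} from rfl, Multiset.add_product,
      Multiset.map_add]
    have hu : (Finset.univ : Finset (Finset (Fin (n+1)))) =
        ((Finset.univ : Finset (Finset (Fin n))).map (Finset.mapEmbedding (Fin.succEmb n)).toEmbedding).disjUnion
        ((Finset.univ : Finset (Finset (Fin n))).map
          ⟨fun I => insert 0 (I.map (Fin.succEmb n)), by
            intro I J hIJ
            have hI : ∀ I : Finset (Fin n), (0 : Fin (n+1)) ∉ I.map (Fin.succEmb n) := by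
              intro I; simp
            have := congrArg (fun s => Finset.erase s 0) hIJ
            simp only [Finset.erase_insert (hI _)] at this
            exact Finset.map_injective _ this⟩) (by
            rw [Finset.disjoint_left]
            intro I hI hJ
            simp only [Finset.mem_map, Finset.mem_univ, true_and] at hI hJ
            obtain ⟨I', rfl⟩ := hI
            obtain ⟨J', hJ'⟩ := hJ
            have : (0 : Fin (n+1)) ∈ (Finset.mapEmbedding (Fin.succEmb n)) I' := by
              have h0 : (0 : Fin (n+1)) ∈ insert 0 (J'.map (Fin.succEmb n)) := by simp
              rw [show insert 0 (J'.map (Fin.succEmb n)) = _ from hJ'] at h0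
              exact h0
            simp at this) := by
      symm
      rw [← Finset.card_eq_iff_eq_univ]
      rw [Finset.card_disjUnion, Finset.card_map, Finset.card_map]
      simp [Fintype.card_finset, pow_succ, mul_two]
    rw [hu, Finset.disjUnion_val, Multiset.map_add, Finset.map_val, Finset.map_val,
      Multiset.map_map, Multiset.map_map]
    congr 1
    · simp only [SProd.sprod, Multiset.product, Multiset.map_map, Multiset.singleton_bind]
      refine Multiset.map_congr rfl fun I _ => ?_
      simp [Finset.mapEmbedding_apply]
    · simp only [SProd.sprod, Multiset.product, Multiset.map_map, Multiset.singleton_bind]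
      refine Multiset.map_congr rfl fun I _ => ?_
      change ∏ i ∈ insert 0 (I.map (Fin.succEmb n)), -(b i) = -b 0 * ∏ i ∈ I, -(b i.succ)
      rw [Finset.prod_insert (by simp), Finset.prod_map]
      rfl

theorem smul_bin_one_equiv (a : K) (ha : a ≠ 0) : QF.Equiv (QF.smul a (bin 1)) (bin 1) := by
  have h2 : (2 : K) ≠ 0 := Invertible.ne_zero 2
  let f : (Fin 2 → K) →ₗ[K] (Fin 2 → K) := Matrix.toLin'
    !![(a + 1) / 2, (a - 1) / 2; (a - 1) / 2, (a + 1) / 2]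
  have hf : ∀ x, f x = ![(a + 1) / 2 * x 0 + (a - 1) / 2 * x 1,
      (a - 1) / 2 * x 0 + (a + 1) / 2 * x 1] := by
    intro x
    simp only [f, Matrix.toLin'_apply]
    ext i
    fin_cases i <;> simp [Matrix.mulVec, dotProduct, Fin.sum_univ_two]
  have hinj : Function.Injective f := by
    rw [injective_iff_map_eq_zero]
    intro x hx
    rw [hf] at hx
    have e0 := congrFun hx 0
    have e1 := congrFun hx 1
    simp only [Matrix.cons_val_zero, Matrix.cons_val_one, Pi.zero_apply] at e0 e1
    field_simp at e0 e1
    have d0 : (2 * a) * (x 0 + x 1) = 0 := by linear_combination e0 + e1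
    have d1 : 2 * (x 0 - x 1) = 0 := by linear_combination e0 - e1
    have d0' : x 0 + x 1 = 0 := by simpa [h2, ha] using d0
    have d1' : x 0 - x 1 = 0 := by simpa [h2] using d1
    have c0 : 2 * x 0 = 0 := by linear_combination d0' + d1'
    have c1 : 2 * x 1 = 0 := by linear_combination d0' - d1'
    ext i
    fin_cases i
    · simpa [h2] using c0
    · simpa [h2] using c1
  refine ⟨⟨LinearEquiv.ofInjectiveEndo f hinj, ?_⟩⟩
  suffices H : ∀ x : Fin 2 → K, (QuadraticMap.weightedSumSquares K ![(1 : K), -1]) (f x) =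
    a • (QuadraticMap.weightedSumSquares K ![(1 : K), -1]) x from H
  intro x
  rw [hf]
  simp only [QuadraticMap.weightedSumSquares_apply, Fin.sum_univ_two, Matrix.cons_val_zero,
    Matrix.cons_val_one, smul_eq_mul]
  field_simp
  ring

theorem isHyperbolic_of_hasDiag {φ : QF K} {m : Multiset K}
    (h : HasDiag φ (m + m.map (fun x => -x))) (hm : ∀ x ∈ m, x ≠ 0) : IsHyperbolic φ := by
  induction m using Quotient.inductionOn with
  | h l =>
  have key : ∀ l : List K, (∀ x ∈ l, x ≠ 0) →
      QF.Equiv (sumList (l.map fun a => QF.smul a (bin 1))) (hyperbolics l.length) := by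
    intro l
    induction l with
    | nil => intro _; exact QuadraticMap.Equivalent.refl _
    | cons a l ih =>
      intro hl
      exact QuadraticMap.Equivalent.prod (smul_bin_one_equiv a (hl a (by simp)))
        (ih fun x hx => hl x (by simp [hx]))
  have hd := hasDiag_sumList l (fun a => QF.smul a (bin 1)) (fun a => {a} + {-a}) (by
    intro a _
    have := (hasDiag_bin (1 : K)).smul a
    simpa using this)
  refine ⟨l.length, QuadraticMap.Equivalent.trans (HasDiag.equiv h ?_) (key l (by simpa using hm))⟩
  convert hd using 1
  rw [Multiset.bind_add, Multiset.bind_singleton, Multiset.bind_singleton, Multiset.map_id']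
  rfl

end Diag

end QF

section Springer

theorem coeff_mul_self_two {F : Type} [Field F] (x : LaurentSeries F) (m : ℤ)
    (h : ∀ j < m, x.coeff j = 0) : (x * x).coeff (m + m) = x.coeff m * x.coeff m := by
  rw [HahnSeries.coeff_mul, Finset.sum_eq_single (m, m)]
  · rintro ⟨i, j⟩ hij hne
    rw [Finset.mem_antidiagonal] at hij
    obtain ⟨hi, hj, hs⟩ := hij
    simp only [HahnSeries.mem_support] at hi hj hs
    have hi' : m ≤ i := not_lt.1 fun hlt => hi (h i hlt)
    have hj' : m ≤ j := not_lt.1 fun hlt => hj (h j hlt)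
    exact absurd (Prod.ext (by simp; omega) (by simp; omega)) hne
  · intro hn
    simp only [Finset.mem_antidiagonal, HahnSeries.mem_support, and_true, and_self,
      not_not] at hn
    simp [hn]

theorem coeff_mul_self_two_add_one {F : Type} [Field F] (x : LaurentSeries F) (m : ℤ)
    (h : ∀ j ≤ m, x.coeff j = 0) : (x * x).coeff (m + m + 1) = 0 := by
  rw [HahnSeries.coeff_mul, Finset.sum_eq_zero]
  rintro ⟨i, j⟩ hij
  rw [Finset.mem_antidiagonal] at hij
  obtain ⟨hi, hj, hs⟩ := hij
  simp only [HahnSeries.mem_support] at hi hj hs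
  have hi' : m < i := not_le.1 fun hlt => hi (h i hlt)
  have hj' : m < j := not_le.1 fun hlt => hj (h j hlt)
  omega

theorem coeff_mul_self_odd {F : Type} [Field F] (x : LaurentSeries F) (m : ℤ)
    (h : ∀ j < m, x.coeff j = 0) : (x * x).coeff (m + m - 1) = 0 := by
  rw [HahnSeries.coeff_mul, Finset.sum_eq_zero]
  rintro ⟨i, j⟩ hij
  rw [Finset.mem_antidiagonal] at hij
  obtain ⟨hi, hj, hs⟩ := hij
  simp only [HahnSeries.mem_support] at hi hj hs
  have hi' : m ≤ i := not_lt.1 fun hlt => hi (h i hlt)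
  have hj' : m ≤ j := not_lt.1 fun hlt => hj (h j hlt)
  omega

/-- Springer's theorem for diagonal forms over a Laurent series field. -/
theorem springer_step {F : Type} [Field F] {ι : Type} [Fintype ι] (s : ι → Prop)
    [DecidablePred s] (c : ι → F)
    (h1 : ∀ y : ι → F, ∑ i with s i, c i * (y i * y i) = 0 → ∀ i, s i → y i = 0)
    (h0 : ∀ y : ι → F, ∑ i with ¬ s i, c i * (y i * y i) = 0 → ∀ i, ¬ s i → y i = 0)
    (x : ι → LaurentSeries F)
    (hx : ∑ i, ((if s i then HahnSeries.single (1 : ℤ) (1 : F) else 1) * HahnSeries.C (c i)) *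
      (x i * x i) = 0) : ∀ i, x i = 0 := by
  have hx' : ∀ e : ℤ, ∑ i with s i, c i * (x i * x i).coeff (e - 1) +
      ∑ i with ¬ s i, c i * (x i * x i).coeff e = 0 := by
    intro e
    have := congrArg (fun z : LaurentSeries F => z.coeff e) hx
    simp only [HahnSeries.coeff_sum, HahnSeries.coeff_zero] at this
    rw [← Finset.sum_filter_add_sum_filter_not Finset.univ s] at this
    rw [← this]
    congr 1
    · refine Finset.sum_congr rfl fun i hi => ?_
      rw [if_pos (Finset.mem_filter.1 hi).2, mul_assoc, HahnSeries.C_mul_eq_smul]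
      conv_rhs => rw [← sub_add_cancel e 1]
      rw [HahnSeries.coeff_single_mul_add]
      simp
    · refine Finset.sum_congr rfl fun i hi => ?_
      rw [if_neg (Finset.mem_filter.1 hi).2, one_mul, HahnSeries.C_mul_eq_smul]
      simp
  have step : ∀ m : ℤ, (∀ i, ∀ j < m, (x i).coeff j = 0) → ∀ i, (x i).coeff m = 0 := by
    intro m hm
    have a0 : ∀ i, ¬ s i → (x i).coeff m = 0 := by
      apply h0 (fun i => (x i).coeff m)
      have := hx' (m + m)
      rw [Finset.sum_eq_zero (s := Finset.univ.filter s), zero_add] at this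
      · rw [← this]
        exact Finset.sum_congr rfl fun i _ => by rw [coeff_mul_self_two _ _ (hm i)]
      · intro i _
        rw [coeff_mul_self_odd _ _ (hm i), mul_zero]
    have a1 : ∀ i, s i → (x i).coeff m = 0 := by
      apply h1 (fun i => (x i).coeff m)
      have := hx' (m + m + 1)
      rw [Finset.sum_eq_zero (s := Finset.univ.filter fun i => ¬ s i), add_zero] at this
      · rw [← this]
        exact Finset.sum_congr rfl fun i _ => by
          rw [add_sub_cancel_right, coeff_mul_self_two _ _ (hm i)]
      · intro i hi
        rw [coeff_mul_self_two_add_one, mul_zero]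
        intro j hj
        rcases hj.lt_or_eq with hj | rfl
        · exact hm i j hj
        · exact a0 i (Finset.mem_filter.1 hi).2
    intro i
    by_cases hi : s i
    · exact a1 i hi
    · exact a0 i hi
  obtain ⟨N, hN⟩ : ∃ N : ℤ, ∀ i, N ≤ (x i).order := by
    obtain ⟨N, hN⟩ := (Set.finite_range fun i => (x i).order).bddBelow
    exact ⟨N, fun i => hN ⟨i, rfl⟩⟩
  have all : ∀ d : ℕ, ∀ i, ∀ j < N + d, (x i).coeff j = 0 := by
    intro d
    induction d with
    | zero =>
      intro i j hj
      exact HahnSeries.coeff_eq_zero_of_lt_order (lt_of_lt_of_le (by simpa using hj) (hN i))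
    | succ d ih =>
      intro i j hj
      by_cases hjd : j < N + d
      · exact ih i j hjd
      · have : j = N + d := by push_cast at hj; omega
        rw [this]
        exact step _ ih i
  intro i
  ext j
  exact all (j - N + 1).toNat i j (by omega)

theorem prod_tvar_succ (k : Type) [Field k] (n : ℕ) (J : Finset (Fin (n + 1))) :
    ∏ j ∈ J, tvar k (n + 1) j =
      (((if Fin.last n ∈ J then HahnSeries.single (1 : ℤ) (1 : IterLaurent k n) else 1) *
        HahnSeries.C (∏ j ∈ Finset.univ.filter (fun j : Fin n => j.castSucc ∈ J), tvar k n j) :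
        LaurentSeries (IterLaurent k n)) : IterLaurent k (n + 1)) := by
  have e1 : ∏ j ∈ J, tvar k (n + 1) j =
      ∏ j : Fin (n + 1), if j ∈ J then tvar k (n + 1) j else 1 := by
    rw [Finset.prod_ite_mem, Finset.univ_inter]
  rw [e1, Fin.prod_univ_castSucc, mul_comm, Finset.prod_filter, map_prod]
  have t1 : tvar k (n + 1) (Fin.last n) =
      (HahnSeries.single (1 : ℤ) (1 : IterLaurent k n) : LaurentSeries (IterLaurent k n)) := by
    simp only [tvar, Fin.lastCases_last]; rfl
  have t2 : ∀ j : Fin n, tvar k (n + 1) j.castSucc =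
      (HahnSeries.C (tvar k n j) : LaurentSeries (IterLaurent k n)) := by
    intro j; simp only [tvar, Fin.lastCases_castSucc]; rfl
  rw [t1]
  refine congrArg₂ (fun a b : LaurentSeries (IterLaurent k n) => a * b) rfl ?_
  refine Finset.prod_congr rfl fun j _ => ?_
  by_cases h : j.castSucc ∈ J
  · rw [if_pos h, if_pos h]
    exact t2 j
  · rw [if_neg h, if_neg h]
    have h1 := map_one (HahnSeries.C : IterLaurent k n →+* LaurentSeries (IterLaurent k n))
    exact h1.symm

theorem springer_iter (k : Type) [Field k] (n : ℕ) :
    ∀ (ι : Type) [Fintype ι] (f : ι → Finset (Fin n)) (c : ι → k)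
      (_ : ∀ I, ∀ y : ι → k, ∑ i with f i = I, c i * (y i * y i) = 0 → ∀ i, f i = I → y i = 0)
      (x : ι → IterLaurent k n)
      (_ : ∑ i, ((∏ j ∈ f i, tvar k n j) * iterC k n (c i)) * (x i * x i) = 0),
      ∀ i, x i = 0 := by
  induction n with
  | zero =>
    intro ι _ f c h x hx i
    refine h ∅ x ?_ i (Subsingleton.elim _ _)
    rw [Finset.filter_true_of_mem (fun i _ => Subsingleton.elim _ _)]
    refine Eq.trans ?_ hx
    refine Finset.sum_congr rfl fun i _ => ?_
    rw [Finset.eq_empty_of_isEmpty (f i), Finset.prod_empty, one_mul]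
    rfl
  | succ n ih =>
    intro ι _ f c h x hx
    classical
    let g : ι → Finset (Fin n) := fun i => Finset.univ.filter (fun j : Fin n => j.castSucc ∈ f i)
    have hg : ∀ i i', (Fin.last n ∈ f i ↔ Fin.last n ∈ f i') → g i = g i' → f i = f i' := by
      intro i i' h1 h2
      ext j
      induction j using Fin.lastCases with
      | last => exact h1
      | cast j =>
        have := congrArg (fun s => j ∈ s) h2
        simpa [g] using this
    have main : ∀ (p : ι → Prop) [DecidablePred p],
        (∀ i i', p i → p i' → (Fin.last n ∈ f i ↔ Fin.last n ∈ f i')) →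
        (∀ i i', f i = f i' → p i → p i') →
        ∀ y : ι → IterLaurent k n,
          ∑ i with p i, ((∏ j ∈ g i, tvar k n j) * iterC k n (c i)) * (y i * y i) = 0 →
            ∀ i, p i → y i = 0 := by
      intro p _ hp hp' y hy i hi
      refine ih {i // p i} (fun i => g i) (fun i => c i) ?_ (fun i => y i) ?_ ⟨i, hi⟩
      · intro I z hz ⟨i, hi⟩ hiI
        have := h (f i) (fun i => if hpi : p i then z ⟨i, hpi⟩ else 0) ?_ i rfl
        · simpa [hi] using this
        · rw [← hz]
          refine (Finset.sum_bij_ne_zero (fun a _ _ => a.1) ?_ ?_ ?_ ?_).symm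
          · rintro ⟨a, ha⟩ h1 _
            simp only [Finset.mem_filter, Finset.mem_univ, true_and] at h1 ⊢
            exact hg _ _ (hp _ _ ha hi) (h1.trans hiI.symm)
          · intro a _ _ b _ _ hab
            exact Subtype.ext hab
          · intro b hb hb0
            simp only [Finset.mem_filter, Finset.mem_univ, true_and] at hb
            have hpb := hp' _ _ hb.symm hi
            refine ⟨⟨b, hpb⟩, ?_, ?_, rfl⟩
            · simp only [Finset.mem_filter, Finset.mem_univ, true_and]
              rw [← hiI]
              simp only [g, hb]
            · simpa [hpb] using hb0
          · rintro ⟨a, ha⟩ _ _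
            simp [ha]
      · rw [← hy]
        exact (Finset.sum_subtype (Finset.univ.filter p) (by simp)
          (fun i => ((∏ j ∈ g i, tvar k n j) * iterC k n (c i)) * (y i * y i))).symm
    refine springer_step (F := IterLaurent k n) (fun i => Fin.last n ∈ f i)
      (fun i => (∏ j ∈ g i, tvar k n j) * iterC k n (c i)) ?_ ?_ x ?_
    · exact main _ (fun i i' h h' => by simp [h, h']) (fun i i' h h' => h ▸ h')
    · exact main _ (fun i i' h h' => by simp [h, h']) (fun i i' h h' => h ▸ h')
    · refine Eq.trans ?_ hx
      refine Finset.sum_congr rfl fun i _ => ?_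
      rw [prod_tvar_succ]
      let z : LaurentSeries (IterLaurent k n) := x i
      refine congrArg (fun a : LaurentSeries (IterLaurent k n) => a * (z * z)) ?_
      rw [map_mul, ← mul_assoc]
      rfl

theorem tvar_ne_zero (k : Type) [Field k] (n : ℕ) (i : Fin n) : tvar k n i ≠ 0 := by
  induction n with
  | zero => exact i.elim0
  | succ n ih =>
    induction i using Fin.lastCases with
    | last =>
      have t1 : tvar k (n + 1) (Fin.last n) =
        (HahnSeries.single (1 : ℤ) (1 : IterLaurent k n) : LaurentSeries (IterLaurent k n)) := by
        simp only [tvar, Fin.lastCases_last]; rfl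
      rw [t1]
      exact HahnSeries.single_ne_zero one_ne_zero
    | cast j =>
      have t2 : tvar k (n + 1) j.castSucc =
        (HahnSeries.C (tvar k n j) : LaurentSeries (IterLaurent k n)) := by
        simp only [tvar, Fin.lastCases_castSucc]; rfl
      rw [t2]
      exact HahnSeries.C_ne_zero (ih j)

end Springer

theorem generic_part {K : Type} [Field K] [Invertible (2 : K)] (n : ℕ) (t A : Fin n → K)
    (ht : ∀ i, t i ≠ 0) (hA : ∀ i, A i ≠ 0) :
    let P : Finset (Finset (Fin n)) := Finset.univ.filter (fun I => I.Nonempty)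
    let φ : QF K := QF.sumList (P.toList.map
        (fun I => QF.smul (∏ i ∈ I, t i) (QF.bin (∏ i ∈ I, A i))))
    let m0 : Multiset K := P.val.map (fun I => ∏ i ∈ I, t i) +
      P.val.map (fun I => -((∏ i ∈ I, t i) * ∏ i ∈ I, A i))
    QF.HasDiag φ m0 ∧ QF.Equiv (QF.add φ (QF.bin 1))
      (QF.add (QF.pfister (List.ofFn fun i => -(t i)))
        (QF.smul (-1) (QF.pfister (List.ofFn fun i => -(A i * t i))))) ∧
    QF.InFundPow n φ ∧ φ.dim = 2 ^ (n + 1) - 2 := by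
  intro P φ m0
  classical
  have hφ : QF.HasDiag φ m0 := by
    have h := QF.hasDiag_sumList P.toList
      (fun I => QF.smul (∏ i ∈ I, t i) (QF.bin (∏ i ∈ I, A i)))
      (fun I => {∏ i ∈ I, t i} + {-((∏ i ∈ I, t i) * ∏ i ∈ I, A i)}) (by
        intro I _
        have := (QF.hasDiag_bin (∏ i ∈ I, A i)).smul (∏ i ∈ I, t i)
        rw [Multiset.insert_eq_cons, Multiset.map_cons, Multiset.map_singleton, mul_one,
          mul_neg] at this
        exact this)
    rw [Multiset.bind_add, Multiset.bind_singleton, Multiset.bind_singleton,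
      Finset.coe_toList] at h
    exact h
  have huniv : (Finset.univ : Finset (Finset (Fin n))).val = ∅ ::ₘ P.val := by
    have : (Finset.univ : Finset (Finset (Fin n))) = Finset.cons ∅ P (by simp [P]) := by
      ext I
      simp [P, Finset.nonempty_iff_ne_empty, em]
    rw [this, Finset.cons_val]
  have hm : m0 + {1, -1} =
      ((Finset.univ : Finset (Finset (Fin n))).val.map fun I => ∏ i ∈ I, -(-(t i))) +
      (((Finset.univ : Finset (Finset (Fin n))).val.map fun I =>
        ∏ i ∈ I, -(-(A i * t i))).map ((-1 : K) * ·)) := by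
    have e : ∀ I : Finset (Fin n), (-1 : K) * ∏ i ∈ I, -(-(A i * t i)) =
        -((∏ i ∈ I, t i) * ∏ i ∈ I, A i) := by
      intro I
      simp only [neg_neg, Finset.prod_mul_distrib]
      ring
    simp only [Multiset.map_map, Function.comp_def, e]
    rw [huniv]
    simp only [neg_neg, Multiset.map_cons, Finset.prod_empty, mul_one, m0]
    simp only [Multiset.insert_eq_cons, ← Multiset.singleton_add]
    abel
  have hP1 := QF.hasDiag_pfister n (fun i => -(t i))
  have hP2 := (QF.hasDiag_pfister n (fun i => -(A i * t i))).smul (-1)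
  have hm0 : ∀ x ∈ m0, x ≠ 0 := by
    intro x hx
    simp only [m0, Multiset.mem_add, Multiset.mem_map] at hx
    rcases hx with ⟨I, _, rfl⟩ | ⟨I, _, rfl⟩
    · exact Finset.prod_ne_zero_iff.2 fun i _ => ht i
    · exact neg_ne_zero.2 (mul_ne_zero (Finset.prod_ne_zero_iff.2 fun i _ => ht i)
        (Finset.prod_ne_zero_iff.2 fun i _ => hA i))
  refine ⟨hφ, ?_, ?_, ?_⟩
  · have h1 := hφ.add (QF.hasDiag_bin (1 : K))
    rw [hm] at h1
    exact h1.equiv (hP1.add hP2)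
  · refine ⟨2, ![1, -1], ![fun i => -(t i), fun i => -(A i * t i)], ?_, ?_⟩
    · intro i
      fin_cases i <;> simp
    · have hS : QF.HasDiag (QF.sumList ((List.finRange 2).map fun i =>
          QF.smul ((![1, -1] : Fin 2 → K) i) (QF.pfister (List.ofFn
            ((![fun i => -(t i), fun i => -(A i * t i)] : Fin 2 → Fin n → K) i)))))
          (m0 + {1, -1}) := by
        have h1 := (hP1.smul 1).add (hP2.add QF.hasDiag_zero)
        rw [add_zero] at h1
        simp only [one_mul, Multiset.map_id'] at h1
        rw [hm]
        exact h1
      refine QF.isHyperbolic_of_hasDiag (m := m0 + {1}) ?_ ?_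
      · have h2 := hφ.add (hS.smul (-1))
        convert h2 using 1
        simp only [Multiset.map_add, neg_one_mul, Multiset.insert_eq_cons, Multiset.map_cons,
          Multiset.map_singleton, neg_neg]
        simp only [← Multiset.singleton_add]
        abel
      · intro x hx
        rw [Multiset.mem_add, Multiset.mem_singleton] at hx
        rcases hx with hx | rfl
        · exact hm0 x hx
        · exact one_ne_zero
  · rw [hφ.dim_eq]
    have hc : P.card + 1 = 2 ^ n := by
      have := congrArg Multiset.card huniv
      rw [Multiset.card_cons, Finset.card_val, Finset.card_val, Finset.card_univ,
        Fintype.card_finset, Fintype.card_fin] at this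
      exact this.symm
    simp only [m0, Multiset.card_add, Multiset.card_map, Finset.card_val]
    rw [pow_succ]
    omega

/-- over `K = k((t₁))…((tₙ))`, for `a₁,…,aₙ ∈ k×` with
`[k(√a₁,…,√aₙ):k] = 2ⁿ`, the form `φ = ⊥_{∅ ≠ I ⊆ {1,…,n}} t_I⟨1,-a_I⟩` satisfies
`φ ⊥ H ≅ ⟨⟨-t₁,…,-tₙ⟩⟩ ⊥ -⟨⟨-a₁t₁,…,-aₙtₙ⟩⟩`, lies in `IⁿK`, has dimension
`2^{n+1} - 2` and is anisotropic. -/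
theorem stmt18 (k : Type) [Field k] [Invertible (2 : k)] (n : ℕ)
    [Invertible (2 : IterLaurent k n)]
    (a : Fin n → k) (ha : ∀ i, a i ≠ 0)
    (hdeg : ∀ S : Finset (Fin n), S.Nonempty → ¬ IsSquare (∏ i ∈ S, a i)) :
    let K := IterLaurent k n
    let t : Fin n → K := tvar k n
    let A : Fin n → K := fun i => iterC k n (a i)
    let φ : QF K := QF.sumList
      (((Finset.univ : Finset (Finset (Fin n))).filter (fun I => I.Nonempty)).toList.map
        (fun I => QF.smul (∏ i ∈ I, t i) (QF.bin (∏ i ∈ I, A i))))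
    QF.Equiv (QF.add φ (QF.bin 1))
      (QF.add (QF.pfister (List.ofFn fun i => -(t i)))
        (QF.smul (-1) (QF.pfister (List.ofFn fun i => -(A i * t i))))) ∧
    QF.InFundPow n φ ∧ φ.dim = 2 ^ (n + 1) - 2 ∧ φ.Anisotropic := by
  intro K t A φ
  classical
  have ht : ∀ i, t i ≠ 0 := tvar_ne_zero k n
  have hA : ∀ i, A i ≠ 0 := fun i => (map_ne_zero (iterC k n)).2 (ha i)
  obtain ⟨hφ, c1, c2, c3⟩ := generic_part (K := IterLaurent k n) n t A ht hA
  refine ⟨c1, c2, c3, ?_⟩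
  let P : Finset (Finset (Fin n)) := Finset.univ.filter (fun I => I.Nonempty)
  have hP : ∀ F : Finset (Fin n) → IterLaurent k n,
      (Finset.univ : Finset P).val.map (fun I => F I.1) = P.val.map F := by
    intro F
    exact Multiset.attach_map_val' P.val F
  let f : P ⊕ P → Finset (Fin n) := Sum.elim Subtype.val Subtype.val
  let c : P ⊕ P → k := Sum.elim (fun _ => 1) (fun I => -∏ i ∈ I.1, a i)
  have hw := hφ.equiv_wss (fun i : P ⊕ P => (∏ j ∈ f i, tvar k n j) * iterC k n (c i)) (by
    rw [← Finset.univ_disjSum_univ, Finset.val_disjSum, Multiset.disjSum,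
      Multiset.map_add, Multiset.map_map, Multiset.map_map]
    congr 1
    · refine Eq.trans ?_ (hP _)
      refine Multiset.map_congr rfl fun I _ => ?_
      simp [f, c, t]
    · refine Eq.trans ?_ (hP _)
      refine Multiset.map_congr rfl fun I _ => ?_
      simp [f, c, t, A])
  obtain ⟨g⟩ := hw
  intro v hv
  have hg : QuadraticMap.weightedSumSquares K
      (fun i : P ⊕ P => (∏ j ∈ f i, tvar k n j) * iterC k n (c i)) (g v) = 0 :=
    (g.map_app v).trans hv
  rw [QuadraticMap.weightedSumSquares_apply] at hg
  have hz := springer_iter k n (P ⊕ P) f c (by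
    intro I y hy i hi
    obtain ⟨J, hJ⟩ : ∃ J : P, J.1 = I := by
      rcases i with J | J
      · exact ⟨J, hi⟩
      · exact ⟨J, hi⟩
    have hfil : (Finset.univ.filter fun i => f i = I) = {Sum.inl J, Sum.inr J} := by
      ext i
      rw [Finset.mem_filter, Finset.mem_insert, Finset.mem_singleton, ← hJ]
      rcases i with L | L
      · exact ⟨fun h => Or.inl (congrArg Sum.inl (Subtype.ext h.2)), fun h =>
          ⟨Finset.mem_univ _, congrArg Subtype.val
            (Sum.inl_injective (h.resolve_right Sum.inl_ne_inr))⟩⟩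
      · exact ⟨fun h => Or.inr (congrArg Sum.inr (Subtype.ext h.2)), fun h =>
          ⟨Finset.mem_univ _, congrArg Subtype.val
            (Sum.inr_injective (h.resolve_left Sum.inr_ne_inl))⟩⟩
    rw [hfil, Finset.sum_pair (by simp)] at hy
    simp only [c, Sum.elim_inl, Sum.elim_inr] at hy
    have hns := hdeg J.1 (Finset.mem_filter.1 J.2).2
    have y1 : y (Sum.inr J) = 0 := by
      by_contra hne
      apply hns
      refine ⟨y (Sum.inl J) / y (Sum.inr J), ?_⟩
      field_simp
      linear_combination -hy
    have y0 : y (Sum.inl J) = 0 := by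
      rw [y1] at hy
      simpa using hy
    have hmem : i ∈ Finset.univ.filter fun i => f i = I := by simp [hi]
    rw [hfil] at hmem
    simp only [Finset.mem_insert, Finset.mem_singleton] at hmem
    rcases hmem with rfl | rfl
    · exact y0
    · exact y1) (g v) hg
  have : g v = 0 := funext hz
  exact (LinearEquiv.map_eq_zero_iff g.toLinearEquiv).1 this
end
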